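/- arXiv:1706.01713 — 5 statements merged into one kernel-verified Lean document; each statement's English description precedes it below -/
import Mathlib

section
/- Let k be an algebraically closed field and ℓ a prime number different from the characteristic of k. An element g ∈ PGL(2,k) is parabolic (i.e. conjugate in PGL(2,k) to the image u of the unipotent matrix [[1,1],[0,1]]) if and only if g is uniquely ℓ-divisible, i.e. there exists exactly one h ∈ PGL(2,k) with h^ℓ = g. -/
open Matrix

/-- The unipotent matrix `[[1,1],[0,1]]` as an element of `GL(2,k)`. -/
def unip (k : Type*) [Field k] : GL (Fin 2) k :=
  ⟨!![1, 1; 0, 1], !![1, -1; 0, 1],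
    by norm_num [Matrix.mul_fin_two, ← Matrix.one_fin_two],
    by norm_num [Matrix.mul_fin_two, ← Matrix.one_fin_two]⟩

open GeneralLinearGroup (upperRightHom mkOfDetNeZero)

/-- The diagonal matrices with invertible entries, as elements of `GL(n,R)`. -/
def Matrix.GeneralLinearGroup.diagonalHom (n R : Type*) [Fintype n] [DecidableEq n] [CommRing R] :
    (n → Rˣ) →* GL n R :=
  (Units.map (diagonalRingHom n R).toMonoidHom).comp MulEquiv.piUnits.symm.toMonoidHom

open GeneralLinearGroup (diagonalHom)

theorem Matrix.GeneralLinearGroup.coe_diagonalHom {n R : Type*} [Fintype n] [DecidableEq n]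
    [CommRing R] (d : n → Rˣ) :
    (diagonalHom n R d : Matrix n n R) = diagonal fun i ↦ (d i : R) := rfl

theorem Matrix.GeneralLinearGroup.coe_diagonalHom_fin_two {R : Type*} [CommRing R]
    (d : Fin 2 → Rˣ) :
    (diagonalHom (Fin 2) R d : Matrix (Fin 2) (Fin 2) R) = !![(d 0 : R), 0; 0, (d 1 : R)] := by
  ext i j; fin_cases i <;> fin_cases j <;> simp [coe_diagonalHom]

theorem unip_eq_upperRightHom (k : Type*) [Field k] : unip k = upperRightHom (1 : k) := rfl

section PGL

variable {n k : Type*} [Fintype n] [DecidableEq n] [Field k]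

theorem mk_center_eq_iff_exists_smul {A B : GL n k} :
    (QuotientGroup.mk A : GL n k ⧸ Subgroup.center (GL n k)) = QuotientGroup.mk B ↔
      ∃ c : k, c ≠ 0 ∧ (B : Matrix n n k) = c • (A : Matrix n n k) := by
  refine ProjGenLinGroup.mk_eq_mk_iff.trans ⟨?_, ?_⟩
  · rintro ⟨u, rfl⟩
    refine ⟨u, u.ne_zero, ?_⟩
    rw [← GeneralLinearGroup.scalar_commute]
    ext i j
    simp [GeneralLinearGroup.coe_scalar]
  · rintro ⟨c, hc, h⟩
    refine ⟨Units.mk0 c hc, Units.ext ?_⟩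
    rw [← GeneralLinearGroup.scalar_commute, h]
    ext i j
    simp [GeneralLinearGroup.coe_scalar]

theorem mk_center_eq_conj {g T : GL n k} (P : Matrix n n k) (hP : P.det ≠ 0) {c : k} (hc : c ≠ 0)
    (h : (g : Matrix n n k) * P = c • (P * T)) :
    ∃ t : GL n k ⧸ Subgroup.center (GL n k),
      t * QuotientGroup.mk T * t⁻¹ = QuotientGroup.mk g := by
  refine ⟨QuotientGroup.mk (mkOfDetNeZero P hP), ?_⟩
  rw [mul_inv_eq_iff_eq_mul, ← QuotientGroup.mk_mul, ← QuotientGroup.mk_mul,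
    mk_center_eq_iff_exists_smul]
  exact ⟨c, hc, h⟩

end PGL

theorem existsUnique_pow_eq_conj_iff {G : Type*} [Group G] (t g : G) (m : ℕ) :
    (∃! h, h ^ m = t * g * t⁻¹) ↔ ∃! h, h ^ m = g := by
  refine ((MulAut.conj t).toEquiv.existsUnique_congr fun {h} ↦ ?_).symm
  simp [conj_pow]

section Field

variable {k : Type*} [Field k]

/-- An invertible upper triangular `2 × 2` matrix is conjugate in `PGL(2,k)` to the standard
unipotent or to a diagonal matrix. -/
theorem conj_unip_or_diagonal_of_upperTriangular (g : GL (Fin 2) k) {a b d : k}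
    (hg : (g : Matrix (Fin 2) (Fin 2) k) = !![a, b; 0, d]) :
    (∃ t : GL (Fin 2) k ⧸ Subgroup.center (GL (Fin 2) k),
      t * QuotientGroup.mk (unip k) * t⁻¹ = QuotientGroup.mk g) ∨
    ∃ (e : Fin 2 → kˣ) (t : GL (Fin 2) k ⧸ Subgroup.center (GL (Fin 2) k)),
      t * QuotientGroup.mk (diagonalHom (Fin 2) k e) * t⁻¹ = QuotientGroup.mk g := by
  have hdet := g.det_ne_zero
  rw [hg, det_fin_two_of, mul_zero, sub_zero] at hdet
  obtain ⟨ha, hd⟩ := mul_ne_zero_iff.mp hdet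
  have hdiag (P : Matrix (Fin 2) (Fin 2) k) (hP : P.det ≠ 0)
      (h : !![a, b; 0, d] * P = P * !![a, 0; 0, d]) :=
    mk_center_eq_conj (g := g) (T := diagonalHom (Fin 2) k ![Units.mk0 a ha, Units.mk0 d hd])
      P hP one_ne_zero (by
        rw [hg, h, one_smul, GeneralLinearGroup.coe_diagonalHom_fin_two]; rfl)
  by_cases had : a = d
  · subst had
    by_cases hb : b = 0
    · subst hb
      exact .inr ⟨_, hdiag 1 (by simp) (by simp)⟩
    · refine .inl (mk_center_eq_conj !![b, 0; 0, a] (by simp [ha, hb]) ha ?_)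
      rw [hg, unip]
      ext i j
      fin_cases i <;> fin_cases j <;> simp [mul_comm]
  · refine .inr ⟨_, hdiag !![1, b; 0, d - a] (by simp [sub_eq_zero, Ne.symm had]) ?_⟩
    ext i j
    fin_cases i <;> fin_cases j <;> simp <;> ring

/-- Over an algebraically closed field, every invertible `2 × 2` matrix is conjugate to an upper
triangular one. -/
theorem exists_conj_upperTriangular [IsAlgClosed k] (g : GL (Fin 2) k) :
    ∃ (t : GL (Fin 2) k) (T : GL (Fin 2) k), T 1 0 = 0 ∧ g = t * T * t⁻¹ := by
  by_cases h : g 1 0 = 0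
  · exact ⟨1, g, h, by simp⟩
  obtain ⟨x, hx⟩ : ∃ x, g 1 0 * x ^ 2 + (g 1 1 - g 0 0) * x - g 0 1 = 0 := by
    obtain ⟨x, hx⟩ := IsAlgClosed.exists_root
      (Polynomial.C (g 1 0) * .X ^ 2 + .C (g 1 1 - g 0 0) * .X + .C (-g 0 1))
      (by rw [Polynomial.degree_quadratic h]; decide)
    exact ⟨x, by simpa [← sub_eq_add_neg] using hx⟩
  let t : GL (Fin 2) k := mkOfDetNeZero !![x, 1; 1, 0] (by simp)
  refine ⟨t, t⁻¹ * g * t, ?_, by group⟩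
  simp [t, mkOfDetNeZero, inv_def, adjugate_fin_two, Matrix.mul_apply, vecMul, dotProduct]
  linear_combination -hx

theorem conj_unip_or_diagonal [IsAlgClosed k] (g : GL (Fin 2) k ⧸ Subgroup.center (GL (Fin 2) k)) :
    (∃ t, t * QuotientGroup.mk (unip k) * t⁻¹ = g) ∨
    ∃ (e : Fin 2 → kˣ) (t : GL (Fin 2) k ⧸ Subgroup.center (GL (Fin 2) k)),
      t * QuotientGroup.mk (diagonalHom (Fin 2) k e) * t⁻¹ = g := by
  obtain ⟨g, rfl⟩ := QuotientGroup.mk_surjective g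
  obtain ⟨t, T, hT, rfl⟩ := exists_conj_upperTriangular g
  have hT' := eta_fin_two (T : Matrix (Fin 2) (Fin 2) k)
  rw [hT] at hT'
  refine (conj_unip_or_diagonal_of_upperTriangular T hT').imp ?_ ?_
  · rintro ⟨s, hs⟩
    exact ⟨QuotientGroup.mk t * s, by simp [← hs, mul_assoc]⟩
  · rintro ⟨e, s, hs⟩
    exact ⟨e, QuotientGroup.mk t * s, by simp [← hs, mul_assoc]⟩

theorem existsUnique_pow_eq_unip {m : ℕ} (hm : (m : k) ≠ 0) :
    ∃! h : GL (Fin 2) k ⧸ Subgroup.center (GL (Fin 2) k),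
      h ^ m = QuotientGroup.mk (unip k) := by
  refine ⟨QuotientGroup.mk (upperRightHom (m : k)⁻¹), ?_, fun h hh ↦ ?_⟩
  · simp only [← QuotientGroup.mk_pow]
    rw [← AddChar.map_nsmul_eq_pow, nsmul_eq_mul, mul_inv_cancel₀ hm, unip_eq_upperRightHom]
  obtain ⟨h, rfl⟩ := QuotientGroup.mk_surjective h
  obtain ⟨c, hc, hu⟩ := mk_center_eq_iff_exists_smul.mp ((QuotientGroup.mk_pow _ h m).trans hh)
  have hcomm : (h : Matrix (Fin 2) (Fin 2) k) * unip k = unip k * h := by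
    rw [hu, mul_smul_comm, smul_mul_assoc, Units.val_pow_eq_pow_val, ← pow_succ, ← pow_succ']
  have h00 := congrFun₂ hcomm 0 0
  have h01 := congrFun₂ hcomm 0 1
  simp [unip, Matrix.mul_apply, Fin.sum_univ_two] at h00 h01
  have hne := h.det_ne_zero
  rw [det_fin_two, h00, mul_zero, sub_zero] at hne
  have ha := left_ne_zero_of_mul hne
  have hh' : (h : Matrix (Fin 2) (Fin 2) k) =
      h 0 0 • (upperRightHom (h 0 1 / h 0 0) : GL (Fin 2) k).val := by
    ext i j
    fin_cases i <;> fin_cases j <;> simp [h00, mul_div_cancel₀, ha]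
    linear_combination -h01
  have hmk := mk_center_eq_iff_exists_smul.mpr ⟨_, ha, hh'⟩
  rw [← hmk, ← QuotientGroup.mk_pow, ← AddChar.map_nsmul_eq_pow, unip_eq_upperRightHom,
    mk_center_eq_iff_exists_smul] at hh
  obtain ⟨c, -, hu⟩ := hh
  have hc1 := congrFun₂ hu 0 0
  have hc2 := congrFun₂ hu 0 1
  simp at hc1 hc2
  rw [← hmk, eq_inv_of_mul_eq_one_right (a := (m : k)) (b := h 0 1 / h 0 0)]
  rw [← hc1, one_mul] at hc2
  exact hc2.symm

theorem not_existsUnique_pow_eq_diagonal [IsAlgClosed k] {m : ℕ} (hm : (m : k) ≠ 0) (hm1 : m ≠ 1)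
    (e : Fin 2 → kˣ) :
    ¬ ∃! h : GL (Fin 2) k ⧸ Subgroup.center (GL (Fin 2) k),
      h ^ m = QuotientGroup.mk (diagonalHom (Fin 2) k e) := by
  intro hu
  have : NeZero (m : k) := ⟨hm⟩
  have hm0 : m ≠ 0 := by rintro rfl; simp at hm
  obtain ⟨ζ, hζ⟩ := HasEnoughRootsOfUnity.exists_primitiveRoot k m
  have hζ1 : ζ ≠ 1 := hζ.ne_one (by omega)
  have hroot (i : Fin 2) : ∃ z : kˣ, z ^ m = e i := by
    obtain ⟨z, hz⟩ := IsAlgClosed.exists_pow_nat_eq (e i : k) (Nat.pos_of_ne_zero hm0)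
    exact ⟨Units.mk0 z fun h ↦ (e i).ne_zero <| by rw [← hz, h, zero_pow hm0], Units.ext hz⟩
  choose r hr using hroot
  set s : Fin 2 → kˣ := ![(hζ.isUnit hm0).unit, 1]
  have hs : s ^ m = 1 := by
    ext i; fin_cases i <;> simp [s, hζ.pow_eq_one]
  have hpow (f : Fin 2 → kˣ) (hf : f ^ m = e) :
      (QuotientGroup.mk (diagonalHom (Fin 2) k f) : GL (Fin 2) k ⧸ Subgroup.center _) ^ m =
        QuotientGroup.mk (diagonalHom (Fin 2) k e) := by
    rw [← QuotientGroup.mk_pow, ← map_pow, hf]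
  have hr' : r ^ m = e := funext hr
  have heq := hu.unique (hpow r hr') (hpow (r * s) (by rw [mul_pow, hs, hr', mul_one]))
  obtain ⟨c, -, hc⟩ := mk_center_eq_iff_exists_smul.mp heq
  rw [GeneralLinearGroup.coe_diagonalHom_fin_two, GeneralLinearGroup.coe_diagonalHom_fin_two] at hc
  have h0 := congrFun₂ hc 0 0
  have h1 := congrFun₂ hc 1 1
  simp [s] at h0 h1
  rw [h1, mul_comm] at h0
  exact hζ1 (by simpa using h0)

end Field

/-- Let `k` be an algebraically closed field and `ℓ` a prime different
from the characteristic of `k`.  An element `g ∈ PGL(2,k)` is parabolic (conjugate to the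
image `u` of the unipotent matrix `[[1,1],[0,1]]`) if and only if `g` is uniquely
`ℓ`-divisible (there is exactly one `h` with `h ^ ℓ = g`). -/
theorem stmt14 {k : Type*} [Field k] [IsAlgClosed k] (ℓ : ℕ) (hℓ : ℓ.Prime)
    (hchar : ringChar k ≠ ℓ)
    (g : GL (Fin 2) k ⧸ Subgroup.center (GL (Fin 2) k)) :
    (∃ t, t * QuotientGroup.mk (unip k) * t⁻¹ = g) ↔ (∃! h, h ^ ℓ = g) := by
  have hℓk : (ℓ : k) ≠ 0 := fun h ↦
    ((Nat.dvd_prime hℓ).mp (ringChar.dvd h)).elim CharP.ringChar_ne_one hchar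
  constructor
  · rintro ⟨t, rfl⟩
    exact (existsUnique_pow_eq_conj_iff _ _ _).mpr (existsUnique_pow_eq_unip hℓk)
  · intro hu
    refine (conj_unip_or_diagonal g).resolve_right ?_
    rintro ⟨e, t, rfl⟩
    exact not_existsUnique_pow_eq_diagonal hℓk hℓ.ne_one e
      ((existsUnique_pow_eq_conj_iff _ _ _).mp hu)
end

section
/- Let k and k' be arbitrary fields, and let K|k and K'|k' be field extensions with dim_k K ≥ 3 and dim_{k'} K' ≥ 3. Suppose φ : K'ˣ/k'ˣ → Kˣ/kˣ is a map which is simultaneously a homomorphism of abelian groups and a projective embedding. Then there exists a unique field homomorphism Φ : K' → K lifting φ (i.e. for every x' ∈ K'ˣ, the class of Φ(x') modulo kˣ equals φ applied to the class of x' modulo k'ˣ) such that Φ restricts to an isomorphism from k' onto k. -/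
/-- The subgroup `kˣ` of `Kˣ` (image of the units of the base field under `algebraMap`). -/
def scalarUnits (k K : Type*) [Field k] [Field K] [Algebra k K] : Subgroup Kˣ :=
  (Units.map (algebraMap k K).toMonoidHom).range

/-- The projectivization `ℙ_k K = Kˣ/kˣ` of the field extension `K|k`. -/
def ProjQuot (k K : Type*) [Field k] [Field K] [Algebra k K] :=
  Kˣ ⧸ scalarUnits k K

noncomputable instance (k K : Type*) [Field k] [Field K] [Algebra k K] :
    CommGroup (ProjQuot k K) :=
  QuotientGroup.Quotient.commGroup (scalarUnits k K)

/-- A subset of `Kˣ/kˣ` is a (projective) line if it consists exactly of the classes of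
the nonzero elements of a 2-dimensional `k`-subspace of `K`. -/
def IsLine (k K : Type*) [Field k] [Field K] [Algebra k K] (S : Set (ProjQuot k K)) : Prop :=
  ∃ f g : K, LinearIndependent k ![f, g] ∧
    S = {q : ProjQuot k K | ∃ x : Kˣ, (x : K) ∈ Submodule.span k ({f, g} : Set K) ∧
      (QuotientGroup.mk x : ProjQuot k K) = q}

theorem mem_span_one_of_mem_bot {k K : Type*} [Field k] [Field K] [Algebra k K] {x : K} (y : K)
    (hx : x ∈ (⊥ : IntermediateField k K)) : x ∈ Submodule.span k ({1, y} : Set K) := by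
  obtain ⟨a, rfl⟩ := IntermediateField.mem_bot.1 hx
  rw [Algebra.algebraMap_eq_smul_one]
  exact Submodule.smul_mem _ _ (Submodule.subset_span (by simp))

theorem mul_mem_span_of_mem_bot {k K : Type*} [Field k] [Field K] [Algebra k K] {x : K} (y z : K)
    (hx : x ∈ (⊥ : IntermediateField k K)) : x * y ∈ Submodule.span k ({z, y} : Set K) := by
  obtain ⟨a, rfl⟩ := IntermediateField.mem_bot.1 hx
  rw [← Algebra.smul_def]
  exact Submodule.smul_mem _ _ (Submodule.subset_span (by simp))

/-- A function which is additive and compatible with quotients on triples `1, x, y` that are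
linearly independent over `k` agrees outside `k` with a ring homomorphism. -/
theorem exists_ringHom_eq_off_bot {k K L : Type*} [Field k] [Field K] [Field L] [Algebra k K]
    (hdim : ∀ x : K, ∃ w, w ∉ Submodule.span k ({1, x} : Set K)) (ψ : K → L)
    (h0 : ∀ x ∉ (⊥ : IntermediateField k K), ψ x ≠ 0)
    (hadd : ∀ x ∉ (⊥ : IntermediateField k K), ∀ y ∉ Submodule.span k ({1, x} : Set K),
      ψ (x + y) = ψ x + ψ y)
    (hdiv : ∀ x ∉ (⊥ : IntermediateField k K), ∀ y ∉ Submodule.span k ({1, x} : Set K),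
      ψ (y / x) = ψ y / ψ x) :
    ∃ Φ : K →+* L, ∀ x ∉ (⊥ : IntermediateField k K), Φ x = ψ x := by
  classical
  set B : IntermediateField k K := ⊥ with hB
  have ne0 : ∀ {x : K}, x ∉ B → x ≠ 0 := fun hx h => hx (h ▸ B.zero_mem)
  have hmul : ∀ u v : K, u ∉ B → v ∉ B → u * v ∉ B → ψ (u * v) = ψ u * ψ v := by
    intro u v hu hv huv
    by_cases hS : u * v ∈ Submodule.span k ({1, v} : Set K)
    · obtain ⟨w, hw⟩ := hdim v
      have hvS : v ∈ Submodule.span k ({1, v} : Set K) := Submodule.subset_span (by simp)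
      have h1S : (1 : K) ∈ Submodule.span k ({1, v} : Set K) := Submodule.subset_span (by simp)
      have hwB : w ∉ B := fun h => hw (mem_span_one_of_mem_bot _ h)
      have e1 := hdiv (u * v) huv w fun h => hw <| by
        obtain ⟨c, d, rfl⟩ := Submodule.mem_span_pair.1 h
        exact add_mem (Submodule.smul_mem _ _ h1S) (Submodule.smul_mem _ _ hS)
      have e2 := hdiv v hv w hw
      have e3 := hdiv u hu (w / v) fun h => hw <| by
        obtain ⟨c, d, h⟩ := Submodule.mem_span_pair.1 h
        have : w = c • v + d • (u * v) := by
          rw [eq_div_iff (ne0 hv), add_mul, smul_mul_assoc, smul_mul_assoc, one_mul] at h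
          exact h.symm
        rw [this]
        exact add_mem (Submodule.smul_mem _ _ hvS) (Submodule.smul_mem _ _ hS)
      have e4 : w / v / u = w / (u * v) := by rw [div_div, mul_comm]
      rw [e4, e1, e2] at e3
      have := h0 _ hu; have := h0 _ hv; have := h0 _ huv; have := h0 _ hwB
      field_simp at e3
      linear_combination -e3
    · have := hdiv v hv (u * v) hS
      rw [mul_div_cancel_right₀ _ (ne0 hv)] at this
      rw [this, div_mul_cancel₀ _ (h0 _ hv)]
  have mulB : ∀ {c x : K}, c ∈ B → c ≠ 0 → x ∉ B → c * x ∉ B := by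
    intro c x hc hc0 hx h
    exact hx (by simpa [hc0] using B.mul_mem (B.inv_mem hc) h)
  have hscal : ∀ c ∈ B, c ≠ 0 → ∀ f ∉ B, ∀ y ∉ B, ψ (c * f) * ψ y = ψ (c * y) * ψ f := by
    intro c hc hc0
    have key : ∀ f ∉ B, ∀ y ∉ B, y / f ∉ B → ψ (c * f) * ψ y = ψ (c * y) * ψ f := by
      intro f hf y hy hyf
      have hf0 := ne0 hf
      have a1 : c * y = (y / f) * (c * f) := by field_simp
      have a2 : y = (y / f) * f := by field_simp
      have e1 := hmul (y / f) (c * f) hyf (mulB hc hc0 hf) (a1 ▸ mulB hc hc0 hy)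
      have e2 := hmul (y / f) f hyf hf (a2 ▸ hy)
      rw [← a1] at e1
      rw [← a2] at e2
      rw [e1, e2]; ring
    intro f hf y hy
    by_cases hyf : y / f ∈ B
    · obtain ⟨w, hw⟩ := hdim f
      have hwB : w ∉ B := fun h => hw (mem_span_one_of_mem_bot _ h)
      have hwf : w / f ∉ B := fun h => hw <| by
        have := mul_mem_span_of_mem_bot f 1 h
        rwa [div_mul_cancel₀ _ (ne0 hf)] at this
      have hyw : y / w ∉ B := fun h => hwf <| by
        have := B.mul_mem (B.inv_mem h) hyf
        have e : (y / w)⁻¹ * (y / f) = w / f := by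
          have := ne0 hy; have := ne0 hf; have := ne0 hwB
          field_simp
        rwa [e] at this
      have e1 := key f hf w hwB hwf
      have e2 := key w hwB y hy hyw
      apply mul_right_cancel₀ (h0 _ hwB)
      linear_combination ψ y * e1 + ψ f * e2
    · exact key f hf y hy hyf
  obtain ⟨f, hfS⟩ := hdim 0
  have hf : f ∉ B := fun h => hfS (mem_span_one_of_mem_bot _ h)
  let F : K → L := fun x => if x = 0 then 0 else if x ∈ B then ψ (x * f) / ψ f else ψ x
  have F0 : F 0 = 0 := if_pos rfl
  have Foff : ∀ {x}, x ∉ B → F x = ψ x := fun {x} hx => by simp [F, hx, ne0 hx]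
  have F1 : F 1 = 1 := by simp [F, h0 _ hf]
  have Fscal : ∀ c ∈ B, ∀ y ∉ B, F (c * y) = F c * F y := by
    intro c hc y hy
    by_cases hc0 : c = 0
    · simp [hc0, F0]
    · rw [Foff (mulB hc hc0 hy), Foff hy]
      have := h0 _ hf
      simp only [F, hc0, hc, if_true, if_false]
      field_simp
      linear_combination -hscal c hc hc0 f hf y hy
  have Fmul : ∀ x y, F (x * y) = F x * F y := by
    intro x y
    by_cases hx : x ∈ B
    · by_cases hy : y ∈ B
      · by_cases hy0 : y = 0
        · simp [hy0, F0]
        have e1 := Fscal (x * y) (B.mul_mem hx hy) f hf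
        have e2 := Fscal x hx (y * f) (mulB hy hy0 hf)
        rw [Fscal y hy f hf, ← mul_assoc, e1, ← mul_assoc] at e2
        exact mul_right_cancel₀ (by rw [Foff hf]; exact h0 _ hf) e2
      · exact Fscal x hx y hy
    · by_cases hy : y ∈ B
      · rw [mul_comm, Fscal y hy x hx, mul_comm]
      · by_cases hxy : x * y ∈ B
        · obtain ⟨w, hw⟩ := hdim y⁻¹
          have hwB : w ∉ B := fun h => hw (mem_span_one_of_mem_bot _ h)
          have hyw : y * w ∉ B := fun h => hw <| by
            have := mul_mem_span_of_mem_bot y⁻¹ 1 h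
            rwa [mul_right_comm, mul_inv_cancel₀ (ne0 hy), one_mul] at this
          have hxyw : x * y * w ∉ B := mulB hxy (mul_ne_zero (ne0 hx) (ne0 hy)) hwB
          have e1 := Fscal (x * y) hxy w hwB
          rw [Foff hxyw, mul_assoc, hmul x (y * w) hx hyw (by rwa [← mul_assoc]),
            hmul y w hy hwB hyw, ← mul_assoc, ← Foff hx, ← Foff hy, ← Foff hwB] at e1
          exact (mul_right_cancel₀ (by rw [Foff hwB]; exact h0 _ hwB) e1).symm
        · rw [Foff hx, Foff hy, Foff hxy, hmul x y hx hy hxy]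
  have Fone : ∀ y ∉ B, F (1 + y) = 1 + F y := by
    intro y hy
    obtain ⟨w, hw⟩ := hdim y
    have hwB : w ∉ B := fun h => hw (mem_span_one_of_mem_bot _ h)
    have hw0 := ne0 hwB
    have hwi : w⁻¹ ∉ B := fun h => hwB (by simpa using B.inv_mem h)
    have hS : w⁻¹ * y ∉ Submodule.span k ({1, w⁻¹} : Set K) := by
      intro h
      obtain ⟨c, d, h⟩ := Submodule.mem_span_pair.1 h
      have h' : y = c • w + d • (1 : K) := by
        have := congrArg (fun t => t * w) h
        simp only [add_mul, smul_mul_assoc, one_mul, inv_mul_cancel₀ hw0] at this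
        rw [this]; field_simp
      have hc : c ≠ 0 := by
        rintro rfl
        apply hy
        rw [h', zero_smul, zero_add, ← Algebra.algebraMap_eq_smul_one]
        exact B.algebraMap_mem d
      apply hw
      refine Submodule.mem_span_pair.2 ⟨-(c⁻¹ * d), c⁻¹, ?_⟩
      rw [h', smul_add, smul_smul, smul_smul, inv_mul_cancel₀ hc, neg_smul, one_smul]
      abel
    have hyB : w⁻¹ * y ∉ B := fun h => hS (mem_span_one_of_mem_bot _ h)
    have hsB : w⁻¹ + w⁻¹ * y ∉ B := by
      intro h
      apply hS
      have := Submodule.sub_mem _ (mem_span_one_of_mem_bot w⁻¹ h)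
        (Submodule.subset_span (s := ({1, w⁻¹} : Set K)) (R := k) (by simp : w⁻¹ ∈ _))
      simpa using this
    have e := hadd w⁻¹ hwi _ hS
    rw [← Foff hwi, ← Foff hyB, ← Foff hsB] at e
    have a : w⁻¹ + w⁻¹ * y = w⁻¹ * (1 + y) := by ring
    rw [a, Fmul, Fmul] at e
    apply mul_left_cancel₀ (by rw [Foff hwi]; exact h0 _ hwi : F w⁻¹ ≠ 0)
    rw [e]; ring
  have Foff_add : ∀ c ∈ B, ∀ y ∉ B, F (c + y) = F c + F y := by
    intro c hc y hy
    by_cases hc0 : c = 0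
    · simp [hc0, F0]
    · have a : c + y = c * (1 + c⁻¹ * y) := by field_simp
      have b : y = c * (c⁻¹ * y) := by field_simp
      rw [a, Fmul, Fone _ (mulB (B.inv_mem hc) (inv_ne_zero hc0) hy), mul_add, mul_one,
        ← Fmul, ← b]
  have Fone' : ∀ y, F (1 + y) = 1 + F y := by
    intro y
    by_cases hy : y ∈ B
    · have e1 := Foff_add (1 + y) (B.add_mem B.one_mem hy) f hf
      have hyf : y + f ∉ B := fun h => hf (by simpa using B.sub_mem h hy)
      rw [add_assoc, Fone _ hyf, Foff_add y hy f hf] at e1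
      linear_combination -e1
    · exact Fone y hy
  have Fadd : ∀ x y, F (x + y) = F x + F y := by
    intro x y
    by_cases hx : x = 0
    · simp [hx, F0]
    · have a : x + y = x * (1 + x⁻¹ * y) := by field_simp
      have b : y = x * (x⁻¹ * y) := by field_simp
      rw [a, Fmul, Fone', mul_add, mul_one, ← Fmul, ← b]
  exact ⟨{ toFun := F, map_zero' := F0, map_one' := F1, map_add' := Fadd, map_mul' := Fmul },
    fun x hx => Foff hx⟩

/-- The class of a unit of `K` as a homomorphism onto `Kˣ/kˣ`. -/
noncomputable def projClass (k K : Type*) [Field k] [Field K] [Algebra k K] :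
    Kˣ →* ProjQuot k K :=
  QuotientGroup.mk' (scalarUnits k K)

theorem projClass_surjective (k K : Type*) [Field k] [Field K] [Algebra k K] :
    Function.Surjective (projClass k K) :=
  QuotientGroup.mk'_surjective _

theorem projClass_eq_iff {k K : Type*} [Field k] [Field K] [Algebra k K] {x y : Kˣ} :
    projClass k K x = projClass k K y ↔ ∃ c : k, (y : K) = c • (x : K) := by
  refine Iff.trans (QuotientGroup.eq (s := scalarUnits k K)) ⟨?_, ?_⟩
  · rintro ⟨c, hc⟩
    refine ⟨c, ?_⟩
    have : y = x * Units.map (algebraMap k K).toMonoidHom c := by rw [hc]; simp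
    rw [this, Algebra.smul_def, mul_comm]
    rfl
  · rintro ⟨c, hc⟩
    have hc0 : c ≠ 0 := by
      rintro rfl
      simp at hc
    refine ⟨Units.mk0 c hc0, ?_⟩
    ext
    have hx := x.ne_zero
    simp [hc, Algebra.smul_def]
    field_simp

section

variable {k' K' k K : Type*} [Field k'] [Field K'] [Algebra k' K'] [Field k] [Field K] [Algebra k K]

/-- `X` represents the image under `φ` of the class of `x`. -/
def Represents (φ : ProjQuot k' K' →* ProjQuot k K) (x : K') (X : K) : Prop :=
  ∃ (u : K'ˣ) (v : Kˣ), (u : K') = x ∧ (v : K) = X ∧ φ (projClass k' K' u) = projClass k K v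

namespace Represents

variable {φ : ProjQuot k' K' →* ProjQuot k K} {x y : K'} {X Y : K}

theorem ne_zero_left (h : Represents φ x X) : x ≠ 0 := by
  obtain ⟨u, v, rfl, rfl, h⟩ := h; exact u.ne_zero

theorem ne_zero_right (h : Represents φ x X) : X ≠ 0 := by
  obtain ⟨u, v, rfl, rfl, h⟩ := h; exact v.ne_zero

theorem exists_right (φ : ProjQuot k' K' →* ProjQuot k K) (hx : x ≠ 0) :
    ∃ X, Represents φ x X := by
  obtain ⟨v, hv⟩ := projClass_surjective k K (φ (projClass k' K' (Units.mk0 x hx)))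
  exact ⟨v, Units.mk0 x hx, v, rfl, rfl, hv.symm⟩

theorem one : Represents φ 1 1 := ⟨1, 1, rfl, rfl, by simp⟩

theorem mul (hx : Represents φ x X) (hy : Represents φ y Y) : Represents φ (x * y) (X * Y) := by
  obtain ⟨u, v, rfl, rfl, h⟩ := hx
  obtain ⟨u', v', rfl, rfl, h'⟩ := hy
  exact ⟨u * u', v * v', by simp, by simp, by simp [h, h']⟩

theorem div (hx : Represents φ x X) (hy : Represents φ y Y) : Represents φ (x / y) (X / Y) := by
  obtain ⟨u, v, rfl, rfl, h⟩ := hx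
  obtain ⟨u', v', rfl, rfl, h'⟩ := hy
  exact ⟨u / u', v / v', by simp, by simp, by simp [h, h']⟩

theorem exists_smul_right (hX : Represents φ x X) (hY : Represents φ x Y) :
    ∃ c : k, Y = c • X := by
  obtain ⟨u, v, rfl, rfl, h⟩ := hX
  obtain ⟨u', v', hu, rfl, h'⟩ := hY
  obtain rfl := Units.ext hu
  exact projClass_eq_iff.1 (h.symm.trans h')

theorem exists_smul_left (hinj : Function.Injective φ) (hx : Represents φ x X)
    (hy : Represents φ y X) : ∃ c : k', y = c • x := by
  obtain ⟨u, v, rfl, rfl, h⟩ := hx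
  obtain ⟨u', v', rfl, hv, h'⟩ := hy
  obtain rfl := Units.ext hv
  exact projClass_eq_iff.1 (hinj (h.trans h'.symm))

theorem smul_right (h : Represents φ x X) {c : k} (hc : c ≠ 0) : Represents φ x (c • X) := by
  have hX := smul_ne_zero hc h.ne_zero_right
  obtain ⟨u, v, rfl, rfl, h⟩ := h
  exact ⟨u, Units.mk0 _ hX, rfl, rfl, h.trans (projClass_eq_iff.2 ⟨c, rfl⟩)⟩

theorem smul_left (h : Represents φ x X) {c : k'} (hc : c ≠ 0) : Represents φ (c • x) X := by
  have hx := smul_ne_zero hc h.ne_zero_left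
  obtain ⟨u, v, rfl, rfl, h⟩ := h
  exact ⟨Units.mk0 _ hx, v, rfl, rfl, h ▸ congrArg φ (projClass_eq_iff.2 ⟨c, rfl⟩).symm⟩

theorem linearIndependent (hinj : Function.Injective φ) (hxy : LinearIndependent k' ![x, y])
    (hX : Represents φ x X) (hY : Represents φ y Y) : LinearIndependent k ![X, Y] := by
  refine (LinearIndependent.pair_iff' hX.ne_zero_right).2 fun a ha => ?_
  have ha0 : a ≠ 0 := by rintro rfl; exact hY.ne_zero_right (by simpa using ha.symm)
  obtain ⟨c, hc⟩ := (hX.smul_right ha0).exists_smul_left hinj (ha ▸ hY)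
  exact (LinearIndependent.pair_iff' hX.ne_zero_left).1 hxy c hc.symm

end Represents

theorem span_pair_eq_of_mem {f g X Y : K} (hXY : LinearIndependent k ![X, Y])
    (hX : X ∈ Submodule.span k ({f, g} : Set K)) (hY : Y ∈ Submodule.span k ({f, g} : Set K)) :
    Submodule.span k ({X, Y} : Set K) = Submodule.span k {f, g} := by
  have : FiniteDimensional k (Submodule.span k ({f, g} : Set K)) :=
    FiniteDimensional.span_of_finite k (by simp)
  refine Submodule.eq_of_le_of_finrank_le (Submodule.span_le.2 ?_) ?_
  · rintro _ (rfl | rfl) <;> assumption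
  · have h := finrank_span_eq_card hXY
    rw [Matrix.range_cons, Matrix.range_cons, Matrix.range_empty, Set.union_empty,
      Set.singleton_union, Fintype.card_fin] at h
    rw [h]
    classical
    refine (finrank_span_le_card (R := k) ({f, g} : Set K)).trans ?_
    simpa using Finset.card_le_two

theorem represents_line {φ : ProjQuot k' K' →* ProjQuot k K} (hinj : Function.Injective φ)
    (hline : ∀ S : Set (ProjQuot k' K'), IsLine k' K' S → IsLine k K (φ '' S))
    {x y : K'} {X Y : K} (hxy : LinearIndependent k' ![x, y])
    (hX : Represents φ x X) (hY : Represents φ y Y) :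
    (∀ z ∈ Submodule.span k' ({x, y} : Set K'), ∀ Z, Represents φ z Z →
      Z ∈ Submodule.span k ({X, Y} : Set K)) ∧
    (∀ Z ∈ Submodule.span k ({X, Y} : Set K), Z ≠ 0 →
      ∃ z ∈ Submodule.span k' ({x, y} : Set K'), Represents φ z Z) := by
  obtain ⟨f, g, -, hS⟩ := hline _ ⟨x, y, hxy, rfl⟩
  have fwd : ∀ z ∈ Submodule.span k' ({x, y} : Set K'), ∀ Z, Represents φ z Z →
      Z ∈ Submodule.span k ({f, g} : Set K) := by
    rintro _ hz _ ⟨u, v, rfl, rfl, h⟩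
    have : projClass k K v ∈ {q : ProjQuot k K | ∃ x : Kˣ,
        (x : K) ∈ Submodule.span k ({f, g} : Set K) ∧
        (QuotientGroup.mk x : ProjQuot k K) = q} := hS ▸ ⟨_, ⟨u, hz, rfl⟩, h⟩
    obtain ⟨w, hw, h⟩ := this
    obtain ⟨c, hc⟩ := projClass_eq_iff.1 (show projClass k K w = projClass k K v from h)
    exact hc ▸ Submodule.smul_mem _ _ hw
  have hspan := span_pair_eq_of_mem (hX.linearIndependent hinj hxy hY)
    (fwd x (Submodule.subset_span (by simp)) X hX) (fwd y (Submodule.subset_span (by simp)) Y hY)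
  rw [hspan]
  refine ⟨fwd, fun Z hZ hZ0 => ?_⟩
  have : projClass k K (Units.mk0 Z hZ0) ∈ {q : ProjQuot k K | ∃ x : Kˣ,
        (x : K) ∈ Submodule.span k ({f, g} : Set K) ∧
        (QuotientGroup.mk x : ProjQuot k K) = q} := ⟨_, hZ, rfl⟩
  rw [← hS] at this
  obtain ⟨_, ⟨u, hu, rfl⟩, h⟩ := this
  exact ⟨u, hu, u, Units.mk0 Z hZ0, rfl, rfl, h⟩

theorem linearIndependent_triple_iff {x y z : K} : LinearIndependent k ![x, y, z] ↔
    ∀ a b c : k, a • x + b • y + c • z = 0 → a = 0 ∧ b = 0 ∧ c = 0 := by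
  rw [Fintype.linearIndependent_iff]
  constructor
  · intro h a b c habc
    have := h ![a, b, c] (by simpa [Fin.sum_univ_three] using habc)
    exact ⟨this 0, this 1, this 2⟩
  · intro h g hg i
    have := h (g 0) (g 1) (g 2) (by simpa [Fin.sum_univ_three] using hg)
    fin_cases i
    · exact this.1
    · exact this.2.1
    · exact this.2.2

theorem linearIndependent_one_iff {x : K} :
    LinearIndependent k ![1, x] ↔ x ∉ (⊥ : IntermediateField k K) := by
  rw [LinearIndependent.pair_iff' one_ne_zero, IntermediateField.mem_bot]
  simp [Algebra.algebraMap_eq_smul_one]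

theorem linearIndependent_triple_of_notMem_span {x y z : K} (hxy : LinearIndependent k ![x, y])
    (hz : z ∉ Submodule.span k ({x, y} : Set K)) : LinearIndependent k ![x, y, z] := by
  rw [linearIndependent_triple_iff]
  intro a b c h
  have hc : c = 0 := by
    by_contra hc
    refine hz (Submodule.mem_span_pair.2 ⟨-(c⁻¹ * a), -(c⁻¹ * b), ?_⟩)
    have h' : c • z = -(a • x + b • y) := by linear_combination (norm := module) h
    rw [← one_smul k z, ← inv_mul_cancel₀ hc, mul_smul, h']
    module
  subst hc
  have := LinearIndependent.pair_iff.1 hxy a b (by simpa using h)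
  exact ⟨this.1, this.2, rfl⟩

/-- `X` is the representative of the image of the class of `x` for which `1 + X` represents the
image of the class of `1 + x`. -/
def NormalizedRepresents (φ : ProjQuot k' K' →* ProjQuot k K) (x : K') (X : K) : Prop :=
  Represents φ x X ∧ Represents φ (1 + x) (1 + X)

namespace NormalizedRepresents

variable {φ : ProjQuot k' K' →* ProjQuot k K} {x y : K'} {X Y : K}

theorem unique (hinj : Function.Injective φ) (hx : x ∉ (⊥ : IntermediateField k' K'))
    (hX : NormalizedRepresents φ x X) (hY : NormalizedRepresents φ x Y) : X = Y := by
  have hli := Represents.one.linearIndependent hinj (linearIndependent_one_iff.2 hx) hX.1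
  obtain ⟨c, hc⟩ := hX.1.exists_smul_right hY.1
  obtain ⟨d, hd⟩ := hX.2.exists_smul_right hY.2
  obtain ⟨h1, h2⟩ := LinearIndependent.pair_iff.1 hli (1 - d) (c - d) (by
    rw [hc] at hd
    linear_combination (norm := module) hd)
  rw [hc, sub_eq_zero.1 h2, ← sub_eq_zero.1 h1, one_smul]

theorem exists_right (hinj : Function.Injective φ)
    (hline : ∀ S : Set (ProjQuot k' K'), IsLine k' K' S → IsLine k K (φ '' S))
    (hx : x ∉ (⊥ : IntermediateField k' K')) : ∃ X, NormalizedRepresents φ x X := by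
  have hli := linearIndependent_one_iff.2 hx
  have hx0 : x ≠ 0 := fun h => hx (h ▸ zero_mem _)
  have hx1 : 1 + x ≠ 0 := fun h => hx (by
    rw [← neg_eq_of_add_eq_zero_right h]
    exact neg_mem (one_mem _))
  obtain ⟨X, hX⟩ := Represents.exists_right φ hx0
  obtain ⟨W, hW⟩ := Represents.exists_right φ hx1
  obtain ⟨a, b, hab⟩ := Submodule.mem_span_pair.1 <|
    (represents_line hinj hline hli .one hX).1 (1 + x)
      (Submodule.mem_span_pair.2 ⟨1, 1, by simp⟩) W hW
  have ha : a ≠ 0 := by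
    rintro rfl
    have hb : b ≠ 0 := by
      rintro rfl
      exact hW.ne_zero_right (by simpa using hab.symm)
    obtain ⟨c, hc⟩ := (hX.smul_right hb).exists_smul_left hinj
      (show Represents φ (1 + x) (b • X) by convert hW; simpa using hab)
    have := LinearIndependent.pair_iff.1 hli 1 (1 - c) (by linear_combination (norm := module) hc)
    exact one_ne_zero this.1
  have hb : b ≠ 0 := by
    rintro rfl
    obtain ⟨c, hc⟩ := (Represents.one.smul_right ha).exists_smul_left hinj
      (show Represents φ (1 + x) (a • 1) by convert hW; simpa using hab)
    have := LinearIndependent.pair_iff.1 hli (1 - c) 1 (by linear_combination (norm := module) hc)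
    exact one_ne_zero this.2
  refine ⟨(a⁻¹ * b) • X, hX.smul_right (mul_ne_zero (inv_ne_zero ha) hb), ?_⟩
  convert hW.smul_right (inv_ne_zero ha)
  rw [← hab, smul_add, smul_smul, smul_smul, inv_mul_cancel₀ ha, one_smul]

theorem add (hinj : Function.Injective φ)
    (hline : ∀ S : Set (ProjQuot k' K'), IsLine k' K' S → IsLine k K (φ '' S))
    (hx : x ∉ (⊥ : IntermediateField k' K')) (hy : y ∉ Submodule.span k' ({1, x} : Set K'))
    (hX : NormalizedRepresents φ x X) (hY : NormalizedRepresents φ y Y) :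
    NormalizedRepresents φ (x + y) (X + Y) := by
  have hli := linearIndependent_one_iff.2 hx
  have hLI := Represents.one.linearIndependent hinj hli hX.1
  have ht := linearIndependent_triple_iff.1 (linearIndependent_triple_of_notMem_span hli hy)
  have hT : ∀ a b c : k, a • (1 : K) + b • X + c • Y = 0 → a = 0 ∧ b = 0 ∧ c = 0 := by
    refine linearIndependent_triple_iff.1 (linearIndependent_triple_of_notMem_span hLI fun h => ?_)
    obtain ⟨z, hz, hzY⟩ := (represents_line hinj hline hli .one hX.1).2 Y h hY.1.ne_zero_right
    obtain ⟨c, hc⟩ := hzY.exists_smul_left hinj hY.1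
    exact hy (hc ▸ Submodule.smul_mem _ _ hz)
  have hsum : 1 + (x + y) ≠ 0 := fun h => one_ne_zero
    (ht 1 1 1 (by linear_combination (norm := module) h)).1
  have hxy : x + y ≠ 0 := fun h => one_ne_zero
    (ht 0 1 1 (by linear_combination (norm := module) h)).2.1
  have hW : Represents φ (1 + (x + y)) (1 + (X + Y)) := by
    obtain ⟨W, hW⟩ := Represents.exists_right φ hsum
    obtain ⟨a, b, hab⟩ := Submodule.mem_span_pair.1 <|
      (represents_line hinj hline (LinearIndependent.pair_iff.2 fun s t h => by
        have := ht s s t (by linear_combination (norm := module) h)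
        exact ⟨this.1, this.2.2⟩) hX.2 hY.1).1 (1 + (x + y))
        (Submodule.mem_span_pair.2 ⟨1, 1, by module⟩) W hW
    obtain ⟨c, d, hcd⟩ := Submodule.mem_span_pair.1 <|
      (represents_line hinj hline (LinearIndependent.pair_iff.2 fun s t h => by
        have := ht s t s (by linear_combination (norm := module) h)
        exact ⟨this.1, this.2.1⟩) hY.2 hX.1).1 (1 + (x + y))
        (Submodule.mem_span_pair.2 ⟨1, 1, by module⟩) W hW
    obtain ⟨h1, -, h3⟩ := hT (a - c) (a - d) (b - c)
      (by linear_combination (norm := module) hab - hcd)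
    rw [sub_eq_zero] at h1 h3
    subst h1
    subst h3
    have hW' : W = b • (1 + (X + Y)) := by rw [← hab]; module
    have hb : b ≠ 0 := by
      rintro rfl
      exact hW.ne_zero_right (by simpa using hW')
    convert hW.smul_right (inv_ne_zero hb)
    rw [hW', smul_smul, inv_mul_cancel₀ hb, one_smul]
  refine ⟨?_, hW⟩
  obtain ⟨V, hV⟩ := Represents.exists_right φ hxy
  obtain ⟨a, b, hab⟩ := Submodule.mem_span_pair.1 <|
    (represents_line hinj hline (LinearIndependent.pair_iff.2 fun s t h => by
      have := ht 0 s t (by linear_combination (norm := module) h)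
      exact this.2) hX.1 hY.1).1 (x + y)
      (Submodule.mem_span_pair.2 ⟨1, 1, by module⟩) V hV
  obtain ⟨c, d, hcd⟩ := Submodule.mem_span_pair.1 <|
    (represents_line hinj hline (LinearIndependent.pair_iff.2 fun s t h => by
      have := ht (s + t) t t (by linear_combination (norm := module) h)
      have ht0 := this.2.1
      subst ht0
      exact ⟨by simpa using this.1, rfl⟩) .one hW).1 (x + y)
      (Submodule.mem_span_pair.2 ⟨-1, 1, by module⟩) V hV
  obtain ⟨-, h2, h3⟩ := hT (-(c + d)) (a - d) (b - d)
    (by linear_combination (norm := module) hab - hcd)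
  rw [sub_eq_zero] at h2 h3
  subst h2
  subst h3
  have hV' : V = b • (X + Y) := by rw [← hab]; module
  have hb : b ≠ 0 := by
    rintro rfl
    exact hV.ne_zero_right (by simpa using hV')
  convert hV.smul_right (inv_ne_zero hb)
  rw [hV', smul_smul, inv_mul_cancel₀ hb, one_smul]

theorem div (hX : NormalizedRepresents φ x X) (hY : NormalizedRepresents φ y Y)
    (hXY : NormalizedRepresents φ (x + y) (X + Y)) : NormalizedRepresents φ (y / x) (Y / X) := by
  refine ⟨hY.1.div hX.1, ?_⟩
  have := hXY.1.div hX.1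
  rwa [add_div, add_div, div_self hX.1.ne_zero_left, div_self hX.1.ne_zero_right] at this

end NormalizedRepresents

theorem exists_notMem_span_one_pair (hK : 3 ≤ Module.rank k K) (x : K) :
    ∃ w, w ∉ Submodule.span k ({1, x} : Set K) := by
  by_contra! h
  have htop : Submodule.span k ({1, x} : Set K) = ⊤ := eq_top_iff.2 fun w _ => h w
  have h1 : Module.rank k K ≤ Cardinal.mk ({1, x} : Set K) := by
    rw [← rank_top, ← htop]
    exact rank_span_le _
  have h2 : Cardinal.mk ({1, x} : Set K) ≤ 2 := by
    refine (Cardinal.mk_insert_le).trans ?_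
    rw [Cardinal.mk_singleton]
    norm_num
  exact absurd (hK.trans (h1.trans h2)) (by norm_num)

theorem Represents.exists_algebraMap_eq {φ : ProjQuot k' K' →* ProjQuot k K} {c : k'} {X : K}
    (h : Represents φ (algebraMap k' K' c) X) : ∃ a : k, algebraMap k K a = X := by
  have hc : c ≠ 0 := by
    rintro rfl
    exact h.ne_zero_left (map_zero _)
  rw [Algebra.algebraMap_eq_smul_one] at h
  obtain ⟨a, ha⟩ := (Represents.one.smul_left hc).exists_smul_right h
  exact ⟨a, by rw [ha, Algebra.algebraMap_eq_smul_one]⟩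

theorem represents_iff_mk_eq {φ : ProjQuot k' K' →* ProjQuot k K} {Φ : K' →+* K} :
    (∀ x : K'ˣ, φ (QuotientGroup.mk x) =
        (QuotientGroup.mk (Units.map Φ.toMonoidHom x) : ProjQuot k K)) ↔
      ∀ x ≠ 0, Represents φ x (Φ x) := by
  constructor
  · intro h x hx
    exact ⟨Units.mk0 x hx, _, rfl, rfl, h _⟩
  · intro h x
    obtain ⟨u, v, hu, hv, h⟩ := h x x.ne_zero
    obtain rfl := Units.ext hu
    obtain rfl : v = Units.map Φ.toMonoidHom u := Units.ext hv
    exact h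

theorem image_range_algebraMap_eq {φ : ProjQuot k' K' →* ProjQuot k K}
    (hK' : 3 ≤ Module.rank k' K') (hinj : Function.Injective φ)
    (hline : ∀ S : Set (ProjQuot k' K'), IsLine k' K' S → IsLine k K (φ '' S))
    {Φ : K' →+* K} (hΦ : ∀ x ≠ 0, Represents φ x (Φ x)) :
    Φ '' Set.range (algebraMap k' K') = Set.range (algebraMap k K) := by
  have hscalar : ∀ c : k', ∃ a : k, algebraMap k K a = Φ (algebraMap k' K' c) := by
    intro c
    by_cases hc : c = 0
    · exact ⟨0, by simp [hc]⟩
    · exact (hΦ _ (by simpa using hc)).exists_algebraMap_eq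
  apply subset_antisymm
  · rintro _ ⟨_, ⟨c, rfl⟩, rfl⟩
    exact hscalar c
  · rintro _ ⟨c, rfl⟩
    obtain ⟨f, hf⟩ := exists_notMem_span_one_pair hK' 0
    have hfB : f ∉ (⊥ : IntermediateField k' K') := fun h => hf (mem_span_one_of_mem_bot _ h)
    have hli := linearIndependent_one_iff.2 hfB
    have hF := hΦ f fun h => hfB (h ▸ zero_mem _)
    have hLI := Represents.one.linearIndependent hinj hli hF
    have hne : algebraMap k K c + Φ f ≠ 0 := fun h => one_ne_zero
      (LinearIndependent.pair_iff.1 hLI c 1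
        (by rw [one_smul, ← Algebra.algebraMap_eq_smul_one, h])).2
    obtain ⟨z, hz, hzZ⟩ := (represents_line hinj hline hli .one hF).2 (algebraMap k K c + Φ f)
      (Submodule.mem_span_pair.2 ⟨c, 1, by rw [one_smul, Algebra.algebraMap_eq_smul_one]⟩) hne
    obtain ⟨a, b, rfl⟩ := Submodule.mem_span_pair.1 hz
    obtain ⟨d, hd⟩ := hzZ.exists_smul_right (hΦ _ hzZ.ne_zero_left)
    have hd0 : d ≠ 0 := by
      rintro rfl
      exact (hΦ _ hzZ.ne_zero_left).ne_zero_right (by simpa using hd)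
    obtain ⟨A, hA⟩ := hscalar a
    obtain ⟨B, hB⟩ := hscalar b
    rw [Algebra.smul_def, Algebra.smul_def, map_add, map_mul, map_mul, ← hA, ← hB, map_one] at hd
    obtain ⟨h1, h2⟩ := LinearIndependent.pair_iff.1 hLI (A - d * c) (B - d) (by
      simp only [Algebra.smul_def, map_sub, map_mul] at hd ⊢
      linear_combination hd)
    rw [sub_eq_zero] at h1 h2
    refine ⟨algebraMap k' K' (a / b), ⟨_, rfl⟩, ?_⟩
    rw [map_div₀, map_div₀, ← hA, ← hB, h1, h2, ← map_div₀, mul_div_cancel_left₀ _ hd0]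

theorem ringHom_eq_of_represents {φ : ProjQuot k' K' →* ProjQuot k K}
    (hK' : 3 ≤ Module.rank k' K') (hinj : Function.Injective φ) {Φ Ψ : K' →+* K}
    (hΦ : ∀ x ≠ 0, Represents φ x (Φ x)) (hΨ : ∀ x ≠ 0, Represents φ x (Ψ x)) : Φ = Ψ := by
  have hoff : ∀ x ∉ (⊥ : IntermediateField k' K'), Φ x = Ψ x := by
    intro x hx
    have hx0 : x ≠ 0 := fun h => hx (h ▸ zero_mem _)
    have hx1 : 1 + x ≠ 0 := fun h => hx (by
      rw [← neg_eq_of_add_eq_zero_right h]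
      exact neg_mem (one_mem _))
    refine NormalizedRepresents.unique hinj hx ⟨hΦ x hx0, ?_⟩ ⟨hΨ x hx0, ?_⟩
    · simpa using hΦ _ hx1
    · simpa using hΨ _ hx1
  obtain ⟨f, hf⟩ := exists_notMem_span_one_pair hK' 0
  have hfB : f ∉ (⊥ : IntermediateField k' K') := fun h => hf (mem_span_one_of_mem_bot _ h)
  ext x
  by_cases hx : x ∈ (⊥ : IntermediateField k' K')
  · have := hoff (x + f) fun h => hfB (by simpa using sub_mem h hx)
    simpa [hoff f hfB] using this
  · exact hoff x hx

theorem exists_ringHom_represents {φ : ProjQuot k' K' →* ProjQuot k K}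
    (hK' : 3 ≤ Module.rank k' K') (hinj : Function.Injective φ)
    (hline : ∀ S : Set (ProjQuot k' K'), IsLine k' K' S → IsLine k K (φ '' S)) :
    ∃ Φ : K' →+* K, ∀ x ≠ 0, Represents φ x (Φ x) := by
  have hdim := exists_notMem_span_one_pair hK'
  have hex : ∀ x, ∃ X, x ∉ (⊥ : IntermediateField k' K') → NormalizedRepresents φ x X := by
    intro x
    by_cases hx : x ∈ (⊥ : IntermediateField k' K')
    · exact ⟨0, fun h => absurd hx h⟩
    · obtain ⟨X, hX⟩ := NormalizedRepresents.exists_right hinj hline hx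
      exact ⟨X, fun _ => hX⟩
  choose ψ hψ using hex
  have hadd : ∀ x ∉ (⊥ : IntermediateField k' K'), ∀ y ∉ Submodule.span k' ({1, x} : Set K'),
      NormalizedRepresents φ (x + y) (ψ x + ψ y) := fun x hx y hy =>
    .add hinj hline hx hy (hψ x hx) (hψ y fun h => hy (mem_span_one_of_mem_bot _ h))
  obtain ⟨Φ, hΦ⟩ := exists_ringHom_eq_off_bot hdim ψ (fun x hx => (hψ x hx).1.ne_zero_right)
    (fun x hx y hy => by
      have hxy : x + y ∉ (⊥ : IntermediateField k' K') := fun h => hy <| by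
        simpa using sub_mem (mem_span_one_of_mem_bot x h)
          (Submodule.subset_span (s := ({1, x} : Set K')) (R := k') (by simp : x ∈ _))
      exact (hψ _ hxy).unique hinj hxy (hadd x hx y hy))
    (fun x hx y hy => by
      have hx0 : x ≠ 0 := fun h => hx (h ▸ zero_mem _)
      have hxy : y / x ∉ (⊥ : IntermediateField k' K') := fun h => hy <| by
        have := mul_mem_span_of_mem_bot x 1 h
        rwa [div_mul_cancel₀ _ hx0] at this
      exact (hψ _ hxy).unique hinj hxy <|
        (hψ x hx).div (hψ y fun h => hy (mem_span_one_of_mem_bot _ h)) (hadd x hx y hy))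
  have hoff : ∀ x ∉ (⊥ : IntermediateField k' K'), Represents φ x (Φ x) :=
    fun x hx => hΦ x hx ▸ (hψ x hx).1
  refine ⟨Φ, fun x hx0 => ?_⟩
  by_cases hx : x ∈ (⊥ : IntermediateField k' K')
  · obtain ⟨f, hf⟩ := hdim 0
    have hfB : f ∉ (⊥ : IntermediateField k' K') := fun h => hf (mem_span_one_of_mem_bot _ h)
    have hf0 : f ≠ 0 := fun h => hfB (h ▸ zero_mem _)
    have hxf : x * f ∉ (⊥ : IntermediateField k' K') := fun h => hfB (by
      simpa [hx0] using mul_mem (inv_mem hx) h)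
    have := (hoff _ hxf).div (hoff _ hfB)
    rwa [← map_div₀, mul_div_cancel_right₀ _ hf0] at this
  · exact hoff x hx

end

/-- Let `K|k` and `K'|k'` be field extensions with `dim_k K ≥ 3` and
`dim_{k'} K' ≥ 3`, and let `φ : K'ˣ/k'ˣ → Kˣ/kˣ` be simultaneously a group homomorphism
and a projective embedding (injective, mapping every line onto a line).  Then there is a
unique field homomorphism `Φ : K' → K` lifting `φ` which restricts to an isomorphism from
`k'` onto `k`. -/
theorem stmt16 {k K k' K' : Type*} [Field k] [Field K] [Algebra k K]
    [Field k'] [Field K'] [Algebra k' K']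
    (hK : 3 ≤ Module.rank k K) (hK' : 3 ≤ Module.rank k' K')
    (φ : ProjQuot k' K' →* ProjQuot k K)
    (hinj : Function.Injective φ)
    (hline : ∀ S : Set (ProjQuot k' K'), IsLine k' K' S → IsLine k K (φ '' S)) :
    ∃! Φ : K' →+* K,
      (∀ x : K'ˣ, φ (QuotientGroup.mk x) =
        (QuotientGroup.mk (Units.map Φ.toMonoidHom x) : ProjQuot k K)) ∧
      Φ '' Set.range (algebraMap k' K') = Set.range (algebraMap k K) := by
  obtain ⟨Φ, hΦ⟩ := exists_ringHom_represents hK' hinj hline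
  refine ⟨Φ, ⟨represents_iff_mk_eq.2 hΦ, image_range_algebraMap_eq hK' hinj hline hΦ⟩, ?_⟩
  rintro Ψ ⟨hΨ, -⟩
  exact ringHom_eq_of_represents hK' hinj (represents_iff_mk_eq.1 hΨ) hΦ
end

section
/- Let F|k be an extension of algebraically closed fields with trdeg(F|k) = 1, and let G_{F|k} = Aut(F|k) carry the topology of pointwise convergence. If λ is a topological group automorphism of G_{F|k} such that λ(U) = U for every compact open subgroup U of G_{F|k}, then λ is the identity. -/
/-- The topology of pointwise convergence on `Aut(F|k)`: the subspace topology induced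
from the product topology on `F → F` with `F` discrete. -/
def autTop (k F : Type*) [Field k] [Field F] [Algebra k F] : TopologicalSpace (F ≃ₐ[k] F) :=
  TopologicalSpace.induced (fun σ => (σ : F → F))
    (@Pi.topologicalSpace F (fun _ => F) (fun _ => ⊥))


open Polynomial IntermediateField

section

variable {k F : Type*} [Field k] [Field F] [Algebra k F]

/-- If `F` is algebraic over `k(x)`, it is algebraic over `k(w)` for every transcendental `w`. -/
theorem Transcendental.isAlgebraic_adjoin_simple {x w : F} (hw : Transcendental k w)
    (hx : Algebra.IsAlgebraic k⟮x⟯ F) : Algebra.IsAlgebraic k⟮w⟯ F := by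
  have hx' : Algebra.IsAlgebraic (Algebra.adjoin k {x}) F := by
    open scoped IntermediateField.algebraAdjoinAdjoin in
    exact (IsFractionRing.comap_isAlgebraic_iff (K := k⟮x⟯)).2 hx
  have hle : Algebra.trdeg k F ≤ 1 := by
    refine (Algebra.IsAlgebraic.trdeg_le_cardinalMk k ({x} : Set F)).trans ?_
    simp
  have hb : IsTranscendenceBasis k (fun _ : Unit ↦ w) :=
    (algebraicIndependent_unique_type_iff.2 hw).isTranscendenceBasis_of_lift_trdeg_le_of_finite
      (by simpa using hle)
  have h := hb.isAlgebraic_field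
  rwa [Set.range_const] at h

/-- A `k`-isomorphism `k(w) ≃ k(w')` extends to `F` when `F` is an algebraic closure of both. -/
theorem Transcendental.exists_algEquiv_apply_eq [IsAlgClosed F] {w w' : F}
    (hw : Transcendental k w) (hw' : Transcendental k w')
    (ha : Algebra.IsAlgebraic k⟮w⟯ F) (ha' : Algebra.IsAlgebraic k⟮w'⟯ F) :
    ∃ σ : F ≃ₐ[k] F, σ w = w' := by
  have : IsAlgClosure k⟮w⟯ F := ⟨inferInstance, ha⟩
  have : IsAlgClosure k⟮w'⟯ F := ⟨inferInstance, ha'⟩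
  let e : k⟮w⟯ ≃ₐ[k] k⟮w'⟯ :=
    (RatFunc.algEquivOfTranscendental w hw).symm.trans (RatFunc.algEquivOfTranscendental w' hw')
  refine ⟨AlgEquiv.ofRingEquiv (f := IsAlgClosure.equivOfEquiv F F e.toRingEquiv) fun a ↦ ?_, ?_⟩
  · rw [IsScalarTower.algebraMap_apply k k⟮w⟯ F, IsAlgClosure.equivOfEquiv_algebraMap]
    simp [← IsScalarTower.algebraMap_apply]
  · have h := IsAlgClosure.equivOfEquiv_algebraMap F F e.toRingEquiv (AdjoinSimple.gen k w)
    simpa [e] using h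

/-- An element fixed by all automorphisms fixing `w` is purely inseparable over `k(w)`. -/
theorem exists_pow_mem_adjoin_simple [IsAlgClosed F] (q : ℕ) [ExpChar k q] {w z : F}
    (ha : Algebra.IsAlgebraic k⟮w⟯ F) (hz : ∀ σ : F ≃ₐ[k] F, σ w = w → σ z = z) :
    ∃ n : ℕ, z ^ q ^ n ∈ k⟮w⟯ := by
  classical
  have : ExpChar k⟮w⟯ q := expChar_of_injective_algebraMap (algebraMap k k⟮w⟯).injective q
  have hn : Normal k⟮w⟯ F := normal_iff.2 fun y ↦
    ⟨(ha.isAlgebraic y).isIntegral, IsAlgClosed.splits _⟩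
  have hd : (minpoly k⟮w⟯ z).natSepDegree = 1 := by
    rw [natSepDegree_eq_of_isAlgClosed F, Finset.card_eq_one]
    refine ⟨z, ?_⟩
    ext y
    simp only [Multiset.mem_toFinset, Finset.mem_singleton]
    rw [← isConjRoot_iff_mem_minpoly_aroots (ha.isAlgebraic z).isIntegral,
      isConjRoot_iff_exists_algEquiv]
    constructor
    · rintro ⟨σ, hσ⟩
      have h := hz (σ.symm.restrictScalars k) (σ.symm.commutes (AdjoinSimple.gen k w))
      rw [← h, ← hσ]
      exact (σ.symm_apply_apply y).symm
    · rintro rfl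
      exact ⟨1, rfl⟩
  obtain ⟨n, y, hy⟩ := (minpoly.natSepDegree_eq_one_iff_pow_mem q).1 hd
  exact ⟨n, hy ▸ y.2⟩

end

/-- The stabilizer of `w` is open. -/
theorem isOpen_stabilizer_autTop {k F : Type*} [Field k] [Field F] [Algebra k F] (w : F) :
    @IsOpen _ (autTop k F) (MulAction.stabilizer (F ≃ₐ[k] F) w : Set (F ≃ₐ[k] F)) := by
  let : TopologicalSpace F := ⊥
  have : DiscreteTopology F := ⟨rfl⟩
  let := autTop k F
  have hc : Continuous fun σ : F ≃ₐ[k] F ↦ (σ : F → F) := continuous_induced_dom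
  exact (isOpen_discrete {w}).preimage ((continuous_apply w).comp hc)

/-- The stabilizer of `w` is compact if `F` is algebraic over `k(w)`. -/
theorem isCompact_stabilizer_autTop {k F : Type*} [Field k] [Field F] [Algebra k F] {w : F}
    (ha : Algebra.IsAlgebraic k⟮w⟯ F) :
    @IsCompact _ (autTop k F) (MulAction.stabilizer (F ≃ₐ[k] F) w : Set (F ≃ₐ[k] F)) := by
  let : TopologicalSpace F := ⊥
  have : DiscreteTopology F := ⟨rfl⟩
  let := autTop k F
  have hi : Topology.IsInducing fun σ : F ≃ₐ[k] F ↦ (σ : F → F) := ⟨rfl⟩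
  rw [hi.isCompact_iff]
  have hK : IsCompact (Set.univ.pi fun y : F ↦ (minpoly k⟮w⟯ y).rootSet F) :=
    isCompact_univ_pi fun y ↦ (rootSet_finite _ _).isCompact
  have hcl : IsClosed {f : F → F | (∀ a b, f (a + b) = f a + f b) ∧ (∀ a b, f (a * b) = f a * f b) ∧
      ∀ c : k⟮w⟯, f c = c} := by
    simp only [Set.ofPred_and, Set.ofPred_forall]
    refine .inter ?_ (.inter ?_ ?_)
    · exact isClosed_iInter fun a ↦ isClosed_iInter fun b ↦
        isClosed_eq (continuous_apply _) (by fun_prop)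
    · exact isClosed_iInter fun a ↦ isClosed_iInter fun b ↦
        isClosed_eq (continuous_apply _) (by fun_prop)
    · exact isClosed_iInter fun c ↦ isClosed_eq (continuous_apply _) continuous_const
  convert hK.inter_right hcl using 1
  ext f
  constructor
  · rintro ⟨σ, hσ, rfl⟩
    have hσ' : ∀ c : k⟮w⟯, σ c = c := fun c ↦
      (IntermediateField.forall_mem_adjoin_smul_eq_self_iff (F := k) (S := {w}) σ).2
        (by simpa using hσ) c c.2
    let τ : F →ₐ[k⟮w⟯] F := { (σ : F →+* F) with commutes' := hσ' }
    refine ⟨fun y _ ↦ ?_, map_add σ, map_mul σ, hσ'⟩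
    rw [mem_rootSet]
    refine ⟨minpoly.ne_zero (ha.isAlgebraic y).isIntegral, ?_⟩
    have h := aeval_algHom_apply τ y (minpoly k⟮w⟯ y)
    rwa [minpoly.aeval, map_zero] at h
  · rintro ⟨-, hadd, hmul, hc⟩
    let τ : F →ₐ[k⟮w⟯] F :=
      { toFun := f
        map_add' := hadd
        map_mul' := hmul
        map_zero' := by simpa using hc 0
        map_one' := by simpa using hc 1
        commutes' := hc }
    let e : F ≃ₐ[k⟮w⟯] F := AlgEquiv.ofBijective τ (ha.algHom_bijective τ)
    exact ⟨e.restrictScalars k, hc (AdjoinSimple.gen k w), rfl⟩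

section

variable {k : Type*} [Field k]

/-- If `R / S` is a reduced fraction multiplied by a constant under `X ↦ ζX`, where `ζ` is a root
of unity of order exceeding the degree of `S`, then `S` is a monomial. -/
theorem IsPrimitiveRoot.exists_eq_C_mul_X_pow_of_dvd_comp {n : ℕ} {ζ : k}
    (hζ : IsPrimitiveRoot ζ n) {R S : k[X]} (hn : S.natDegree < n) (hc : IsCoprime S R)
    (hd : S ∣ R * S.comp (C ζ * X)) : ∃ (c : k) (N : ℕ), S = C c * X ^ N := by
  obtain rfl | hS := eq_or_ne S 0
  · exact ⟨0, 0, by simp⟩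
  have hζ0 : ζ ≠ 0 := hζ.ne_zero (by lia)
  obtain ⟨T, hT⟩ := hc.dvd_of_dvd_mul_left hd
  have hcoeff (i : ℕ) : (S * T).coeff i = S.coeff i * ζ ^ i := by
    rw [← hT, comp_C_mul_X_coeff]
  have hcomp : S * T ≠ 0 := fun h ↦ by
    have h0 := hcoeff S.natDegree
    rw [h, coeff_zero, eq_comm, mul_eq_zero] at h0
    exact h0.elim (by simpa using hS) (pow_ne_zero _ hζ0)
  have hdeg : T.natDegree = 0 := by
    have h := natDegree_comp (p := S) (q := C ζ * X)
    rw [hT, natDegree_mul hS (right_ne_zero_of_mul hcomp), natDegree_C_mul_X _ hζ0] at h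
    lia
  obtain ⟨u, rfl⟩ : ∃ u, T = C u := ⟨_, eq_C_of_natDegree_eq_zero hdeg⟩
  have hu (i : ℕ) (hi : S.coeff i ≠ 0) : u = ζ ^ i := by
    have h := hcoeff i
    rw [coeff_mul_C] at h
    exact mul_left_cancel₀ hi h
  refine ⟨S.leadingCoeff, S.natDegree, ?_⟩
  ext i
  rw [coeff_C_mul, coeff_X_pow]
  split_ifs with h
  · rw [h, mul_one, leadingCoeff]
  · rw [mul_zero]
    by_contra hi
    refine h (hζ.pow_inj ((le_natDegree_of_ne_zero hi).trans_lt hn) hn ?_)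
    rw [← hu i hi, ← hu _ (by simpa using hS)]

/-- Let `u ^ q = R(w) / S(w)` be a reduced fraction, where for every `n` the automorphisms fixing
`w ^ n` fix `u ^ n`. Then `R` and `S` are monomials. -/
theorem Transcendental.exists_eq_C_mul_X_pow {F : Type*} [Field F] [Algebra k F]
    [IsAlgClosed k] [IsAlgClosed F] {w u : F} (hw : Transcendental k w)
    (ha : ∀ v : F, Transcendental k v → Algebra.IsAlgebraic k⟮v⟯ F) (hu0 : u ≠ 0)
    (hu : ∀ (n : ℕ) (σ : F ≃ₐ[k] F), 0 < n → σ (w ^ n) = w ^ n → σ (u ^ n) = u ^ n) {q : ℕ}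
    {R S : k[X]} (hc : IsCoprime R S) (h : Polynomial.aeval w R = u ^ q * Polynomial.aeval w S) :
    (∃ (c : k) (N : ℕ), R = C c * X ^ N) ∧ ∃ (c : k) (N : ℕ), S = C c * X ^ N := by
  obtain ⟨n, hn, hnp⟩ := Nat.exists_infinite_primes (R.natDegree + S.natDegree + ringChar k + 1)
  have : NeZero (n : k) := ⟨fun h0 ↦ by
    rcases (Nat.dvd_prime hnp).1 ((ringChar.spec k n).1 h0) with h1 | h1
    · exact CharP.ringChar_ne_one h1
    · lia⟩
  have : NeZero n := ⟨hnp.ne_zero⟩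
  obtain ⟨ζ, hζ⟩ := HasEnoughRootsOfUnity.exists_primitiveRoot k n
  have hζ0 : ζ ≠ 0 := hζ.ne_zero (by lia)
  have hw' : Transcendental k (algebraMap k F ζ * w) := fun hA ↦ hw <| by
    have := (isAlgebraic_algebraMap (A := F) ζ⁻¹).mul hA
    rwa [map_inv₀, inv_mul_cancel_left₀ (by simpa using hζ0)] at this
  obtain ⟨σ, hσ⟩ := hw.exists_algEquiv_apply_eq hw' (ha _ hw) (ha _ hw')
  have hσu : (σ u / u) ^ n = 1 := by
    rw [div_pow, ← map_pow, hu n σ hnp.pos, div_self (pow_ne_zero _ hu0)]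
    rw [map_pow, hσ, mul_pow, ← map_pow, hζ.pow_eq_one, map_one, one_mul]
  obtain ⟨i, -, hi⟩ := (hζ.map_of_injective (algebraMap k F).injective).eq_pow_of_pow_eq_one hσu
  have hcomp (T : k[X]) : σ (Polynomial.aeval w T) = Polynomial.aeval w (T.comp (C ζ * X)) := by
    rw [aeval_comp, ← aeval_algHom_apply σ, hσ]
    simp
  have key : R.comp (C ζ * X) * S = C (ζ ^ i) ^ q * (R * S.comp (C ζ * X)) := by
    refine transcendental_iff_injective.1 hw ?_
    have h2 := congrArg σ h
    rw [map_mul, hcomp, hcomp, map_pow, ← div_mul_cancel₀ (σ u) hu0, ← hi, ← map_pow] at h2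
    simp only [map_mul, map_pow, aeval_C, h2, h]
    ring
  have hunit : IsUnit (C (ζ ^ i) ^ q) := ((isUnit_C.2 (pow_ne_zero i hζ0).isUnit)).pow q
  refine ⟨hζ.exists_eq_C_mul_X_pow_of_dvd_comp (by lia) hc ?_,
    hζ.exists_eq_C_mul_X_pow_of_dvd_comp (by lia) hc.symm ?_⟩
  · rw [mul_comm, key]
    exact (Dvd.intro _ rfl).mul_left _
  · exact hunit.dvd_mul_left.1 (key ▸ Dvd.intro_left _ rfl)

/-- An automorphism mapping every transcendental `w` to an element fixed by the stabilizer of `w`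
is the identity on transcendental elements. -/
theorem Transcendental.algEquiv_apply_eq_self {F : Type*} [Field F] [Algebra k F]
    [IsAlgClosed k] [IsAlgClosed F] {y : F} (hy : Transcendental k y)
    (ha : ∀ v : F, Transcendental k v → Algebra.IsAlgebraic k⟮v⟯ F) {τ : F ≃ₐ[k] F}
    (hτ : ∀ (w : F) (σ : F ≃ₐ[k] F), Transcendental k w → σ w = w → σ (τ w) = τ w) :
    τ y = y := by
  obtain ⟨p, hp⟩ := ExpChar.exists k
  have : ExpChar F p := expChar_of_injective_algebraMap (algebraMap k F).injective p
  obtain ⟨m, hm⟩ := exists_pow_mem_adjoin_simple p (ha y hy) (hτ y · hy)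
  set q := p ^ m with hq
  let f := (RatFunc.algEquivOfTranscendental y hy).symm ⟨_, hm⟩
  set P := f.num
  set Q := f.denom
  have hQ0 : Q ≠ 0 := f.denom_ne_zero
  have hPQ : IsCoprime P Q := f.isCoprime_num_denom
  have hinj := transcendental_iff_injective.1 hy
  have hPy : Polynomial.aeval y P = τ y ^ q * Polynomial.aeval y Q := by
    have h := RatFunc.algEquivOfTranscendental_apply y hy f
    simp only [f, AlgEquiv.apply_symm_apply] at h
    have hQy : Polynomial.aeval y Q ≠ 0 := fun h0 ↦ hQ0 (hinj (by rw [h0, map_zero]))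
    exact ((eq_div_iff hQy).1 h).symm
  have hty : Transcendental k (τ y) := fun h ↦
    hy ((isAlgebraic_algHom_iff (τ : F →ₐ[k] F) τ.injective).1 h)
  have hmono (a : k) : (∃ (c : k) (N : ℕ), (P - C (a ^ q) * Q).comp (X + C a) = C c * X ^ N) ∧
      ∃ (c : k) (N : ℕ), Q.comp (X + C a) = C c * X ^ N := by
    have htr (v : F) (hv : Transcendental k v) : Transcendental k (v - algebraMap k F a) := fun h ↦
      hv (by simpa using h.add (isAlgebraic_algebraMap a))
    refine (htr _ hy).exists_eq_C_mul_X_pow (u := τ y - algebraMap k F a) (q := q) ha ?_ ?_ ?_ ?_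
    · intro h0
      exact hty (sub_eq_zero.1 h0 ▸ isAlgebraic_algebraMap a)
    · intro n σ hn hσ
      simpa using hτ _ σ ((htr _ hy).pow hn) hσ
    · refine IsCoprime.map (f := compRingHom (X + C a)) ?_
      simpa [sub_eq_add_neg, ← neg_mul, mul_comm] using hPQ.add_mul_right_left (-C (a ^ q))
    · rw [aeval_comp, aeval_comp]
      simp only [map_add, aeval_X, aeval_C, sub_add_cancel, map_sub, map_mul, hPy, map_pow]
      rw [hq, sub_pow_expChar_pow]
      ring
  obtain ⟨c, hQc⟩ : ∃ c, Q = C c := by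
    obtain ⟨c, N, h⟩ := (hmono 0).2
    obtain ⟨d, M, h'⟩ := (hmono 1).2
    rw [C_0, add_zero, comp_X] at h
    obtain rfl | hN := eq_or_ne N 0
    · exact ⟨c, by simpa using h⟩
    have hd : d = 0 := by
      have h0 := congrArg (eval (-1)) h'
      simpa [h, hN, eval_comp] using h0
    refine absurd ?_ hQ0
    rwa [hd, C_0, zero_mul, comp_X_add_C_eq_zero_iff] at h'
  have hc0 : c ≠ 0 := by simpa [hQc] using hQ0
  rw [hQc] at hPy hmono
  have hP0 : P.natDegree ≠ 0 := fun h ↦ by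
    rw [eq_C_of_natDegree_eq_zero h, aeval_C, aeval_C] at hPy
    refine hty.pow (expChar_pow_pos k p m) ?_
    rw [← hq, eq_div_of_mul_eq (by simpa using hc0) hPy.symm, ← map_div₀]
    exact isAlgebraic_algebraMap _
  have hPX : P = C c * X ^ q := by
    refine Polynomial.funext fun a ↦ ?_
    obtain ⟨d, N, h⟩ := (hmono a).1
    have hN : N ≠ 0 := by
      rintro rfl
      have h' := congrArg natDegree h
      rw [natDegree_comp, ← C_mul, natDegree_sub_C] at h'
      simp [hP0] at h'
    have h' := congrArg (eval 0) h
    simp only [eval_comp, eval_sub, eval_mul, eval_add, eval_X, eval_C, zero_add, eval_pow,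
      zero_pow hN, mul_zero, sub_eq_zero] at h'
    rw [h', eval_mul, eval_C, eval_pow, eval_X, mul_comm]
  rw [← sub_eq_zero, ← pow_eq_zero_iff (expChar_pow_pos k p m).ne', sub_pow_expChar_pow,
    sub_eq_zero]
  refine mul_right_cancel₀ (b := algebraMap k F c) (by simpa using hc0) ?_
  rw [hPX, map_mul, map_pow, aeval_C, aeval_X] at hPy
  rw [← hq, ← hPy, mul_comm]

end

/-- Let `F|k` be an extension of algebraically closed fields with
`trdeg(F|k) = 1` (there is a transcendental `x ∈ F` with `F` algebraic over `k(x)`).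
If `λ` is a topological group automorphism of `G_{F|k} = Aut(F|k)` (pointwise-convergence
topology) with `λ(U) = U` for every compact open subgroup `U`, then `λ` is the identity. -/
theorem stmt17 {k F : Type*} [Field k] [Field F] [Algebra k F]
    [IsAlgClosed k] [IsAlgClosed F]
    (htr : ∃ x : F, Transcendental k x ∧
      Algebra.IsAlgebraic (IntermediateField.adjoin k {x}) F)
    (lam : (F ≃ₐ[k] F) ≃* (F ≃ₐ[k] F))
    (hcont : @Continuous _ _ (autTop k F) (autTop k F) lam)
    (hcont' : @Continuous _ _ (autTop k F) (autTop k F) lam.symm)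
    (hfix : ∀ U : Subgroup (F ≃ₐ[k] F),
      @IsCompact _ (autTop k F) (U : Set (F ≃ₐ[k] F)) →
      @IsOpen _ (autTop k F) (U : Set (F ≃ₐ[k] F)) →
      Subgroup.map lam.toMonoidHom U = U) :
    ∀ σ : F ≃ₐ[k] F, lam σ = σ := by
  intro σ
  obtain ⟨x, hx, hxF⟩ := htr
  have ha (v : F) (hv : Transcendental k v) : Algebra.IsAlgebraic k⟮v⟯ F :=
    hv.isAlgebraic_adjoin_simple hxF
  have hstab (w : F) (hw : Transcendental k w) : Subgroup.map lam.toMonoidHom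
      (MulAction.stabilizer (F ≃ₐ[k] F) w) = MulAction.stabilizer (F ≃ₐ[k] F) w :=
    hfix _ (isCompact_stabilizer_autTop (ha w hw)) (isOpen_stabilizer_autTop w)
  have hmem (w : F) (hw : Transcendental k w) (ρ : F ≃ₐ[k] F) : lam ρ w = w ↔ ρ w = w := by
    have h := Subgroup.mem_map_equiv (f := lam) (K := MulAction.stabilizer (F ≃ₐ[k] F) w)
      (x := lam ρ)
    rw [lam.symm_apply_apply] at h
    rwa [hstab w hw] at h
  have hτ {w : F} (hw : Transcendental k w) : (σ⁻¹ * lam σ) w = w := by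
    refine hw.algEquiv_apply_eq_self ha fun w ρ hw hρ ↦ ?_
    have hσw : Transcendental k (σ w) := fun h ↦
      hw ((isAlgebraic_algHom_iff (σ : F →ₐ[k] F) σ.injective).1 h)
    obtain ⟨μ, hμ⟩ := lam.surjective (σ * ρ * σ⁻¹)
    have h1 : μ (σ w) = σ w := (hmem _ hσw μ).1 (by simp [hμ, hρ, AlgEquiv.aut_inv])
    have h2 := (hmem w hw (σ⁻¹ * μ * σ)).2 (by simp [h1, AlgEquiv.aut_inv])
    rw [map_mul, map_mul, map_inv, hμ] at h2
    have h3 : σ (ρ (σ.symm (lam σ w))) = lam σ w := by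
      simpa [AlgEquiv.aut_inv, AlgEquiv.symm_apply_eq] using h2
    simpa [AlgEquiv.aut_inv] using congrArg σ.symm h3
  have hall (y : F) : (σ⁻¹ * lam σ) y = y := by
    by_cases hy : Transcendental k y
    · exact hτ hy
    · have hxy : Transcendental k (x + y) := fun h ↦
        hx (by simpa using h.sub (not_not.1 hy : IsAlgebraic k y))
      have h := hτ hxy
      rwa [map_add, hτ hx, add_right_inj] at h
  ext y
  simpa [AlgEquiv.aut_inv] using congrArg σ (hall y)
end

section
/- Let F|k be an extension of algebraically closed fields with trdeg(F|k) = 1. Suppose σ is a field automorphism of F with σ(k) = k and σ(K) = K for every function field K in F (i.e. every intermediate field k ⊆ K ⊆ F that is finitely generated as a field extension of k and satisfies K ≠ k). Then σ is the identity. -/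
open Polynomial IntermediateField

theorem IsAlgClosed.exists_pow_eq_one_ne_one (k : Type*) [Field k] [IsAlgClosed k] :
    ∃ (n : ℕ) (ζ : k), n ≠ 0 ∧ ζ ^ n = 1 ∧ ζ ≠ 1 := by
  by_cases h2 : (2 : k) = 0
  · obtain ⟨ζ, hζ⟩ := IsAlgClosed.exists_root (X ^ 2 + X + 1 : k[X]) (by
      have : (X ^ 2 + X + 1 : k[X]).degree = 2 := by compute_degree!
      simp [this])
    simp only [IsRoot.def, eval_add, eval_pow, eval_X, eval_one] at hζ
    refine ⟨3, ζ, three_ne_zero, by linear_combination (ζ - 1) * hζ, ?_⟩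
    rintro rfl
    exact one_ne_zero (by linear_combination hζ - h2 : (1 : k) = 0)
  · exact ⟨2, -1, two_ne_zero, by ring, fun h => h2 (by linear_combination -h)⟩

section

variable {k F : Type*} [Field k] [Field F] [Algebra k F] {x y : F}

/-- Two transcendental generators of the same simple extension differ by a Möbius
transformation. -/
theorem Transcendental.exists_moebius_of_adjoin_eq (hx : Transcendental k x)
    (hxy : k⟮x⟯ = k⟮y⟯) :
    ∃ a b c d : k, a * d ≠ b * c ∧
      (algebraMap k F c * x + algebraMap k F d) * y = algebraMap k F a * x + algebraMap k F b := by
  let φ : RatFunc k →ₐ[k] F := k⟮x⟯.val.comp (RatFunc.algEquivOfTranscendental x hx).toAlgHom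
  have hφ (p : k[X]) : φ (algebraMap k[X] (RatFunc k) p) = Polynomial.aeval x p := by
    simp [φ]
  have hy : y ∈ k⟮x⟯ := hxy ▸ mem_adjoin_simple_self k y
  obtain ⟨f, hf⟩ : ∃ f, φ f = y :=
    ⟨(RatFunc.algEquivOfTranscendental x hx).symm ⟨y, hy⟩, by simp [φ]⟩
  have htop : k⟮f⟯ = ⊤ := by
    rw [eq_top_iff, ← RatFunc.adjoin_X, adjoin_simple_le_iff]
    have hmem : φ RatFunc.X ∈ k⟮f⟯.map φ := by
      rw [adjoin_map, Set.image_singleton, hf, ← hxy, ← RatFunc.algebraMap_X, hφ, aeval_X]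
      exact mem_adjoin_simple_self k x
    obtain ⟨g, hg, hgx⟩ := hmem
    exact φ.injective hgx ▸ hg
  have hdeg : max f.num.natDegree f.denom.natDegree = 1 := by
    rw [← RatFunc.finrank_eq_max_natDegree, htop, IntermediateField.finrank_top]
  have hrel : Polynomial.aeval x f.denom * y = Polynomial.aeval x f.num := by
    rw [← hφ, ← hφ, ← hf, ← map_mul, mul_comm]
    congr 1
    nth_rw 1 [← f.num_div_denom]
    exact div_mul_cancel₀ _ (RatFunc.algebraMap_ne_zero f.denom_ne_zero)
  obtain ⟨a, b, hn⟩ := exists_eq_X_add_C_of_natDegree_le_one (le_max_left _ _ |>.trans hdeg.le)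
  obtain ⟨c, d, hd⟩ := exists_eq_X_add_C_of_natDegree_le_one (le_max_right _ _ |>.trans hdeg.le)
  refine ⟨a, b, c, d, fun hdet => ?_, by simpa [hn, hd] using hrel⟩
  obtain ⟨u, v, huv⟩ := f.isCoprime_num_denom
  have hcross : C c * f.num = C a * f.denom := by
    rw [hn, hd]
    have := congrArg (C : k → k[X]) hdet
    simp only [C_mul] at this
    linear_combination -this
  have hc : c = 0 := by
    by_contra hc
    have hunit : IsUnit f.denom := isUnit_of_dvd_unit
      ⟨C a * u + C c * v, by linear_combination u * hcross - C c * huv⟩ (isUnit_C.mpr (.mk0 c hc))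
    have := congr(($hd).coeff 1)
    rw [coeff_eq_zero_of_natDegree_lt (by simp [natDegree_eq_zero_of_isUnit hunit])] at this
    exact hc (by simpa using this.symm)
  have ha : a = 0 := by
    by_contra ha
    have hunit : IsUnit f.num := isUnit_of_dvd_unit
      ⟨C a * u + C c * v, by linear_combination -v * hcross - C a * huv⟩ (isUnit_C.mpr (.mk0 a ha))
    have := congr(($hn).coeff 1)
    rw [coeff_eq_zero_of_natDegree_lt (by simp [natDegree_eq_zero_of_isUnit hunit])] at this
    exact ha (by simpa using this.symm)
  simp [hn, hd, ha, hc] at hdeg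

theorem Transcendental.coeffs_eq_zero_of_quadratic (hx : Transcendental k x) {a b c : k}
    (h : algebraMap k F a * x ^ 2 + algebraMap k F b * x + algebraMap k F c = 0) :
    a = 0 ∧ b = 0 ∧ c = 0 := by
  have hp := transcendental_iff.mp hx (C a * X ^ 2 + C b * X + C c) (by simpa using h)
  refine ⟨?_, ?_, ?_⟩
  · simpa [coeff_X, coeff_C] using congr(($hp).coeff 2)
  · simpa [coeff_X, coeff_C] using congr(($hp).coeff 1)
  · simpa [coeff_X, coeff_C] using congr(($hp).coeff 0)

/-- A Möbius transform of `x` whose `n`-th power lies in `k(x ^ n)` is a multiple of `x` or of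
`x⁻¹`, as soon as `k` contains a nontrivial `n`-th root of unity. -/
theorem Transcendental.eq_mul_or_mul_eq_of_pow_mem_adjoin (hx : Transcendental k x)
    (hxy : k⟮x⟯ = k⟮y⟯) {n : ℕ} (hn0 : n ≠ 0) (hn : y ^ n ∈ k⟮x ^ n⟯) {ζ : k} (hζ : ζ ^ n = 1) (hζ1 : ζ ≠ 1) :
    ∃ c : k, y = algebraMap k F c * x ∨ x * y = algebraMap k F c := by
  obtain ⟨a, b, c, d, hdet, hy⟩ := hx.exists_moebius_of_adjoin_eq hxy
  obtain ⟨p, q, hpq⟩ := (mem_adjoin_simple_iff k _).mp hn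
  by_cases hy0 : y = 0
  · exact ⟨0, by simp [hy0]⟩
  have hq0 : Polynomial.aeval (x ^ n) q ≠ 0 := fun h => hy0 (by simpa [h, hn0] using hpq)
  have hrel : (C c * X + C d) ^ n * p.comp (X ^ n) = (C a * X + C b) ^ n * q.comp (X ^ n) := by
    refine transcendental_iff_injective.mp hx ?_
    rw [eq_div_iff hq0] at hpq
    simp only [map_mul, map_pow, map_add, aeval_C, aeval_X, aeval_comp, ← hy, ← hpq, mul_pow]
    ring
  have hrel' := congr(($hrel).comp (C ζ * X))
  simp only [mul_comp, pow_comp, add_comp, C_comp, X_comp, comp_assoc, mul_pow, ← C_pow, hζ,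
    C_1, one_mul] at hrel'
  have hq : q.comp (X ^ n) ≠ 0 := fun h => hq0 (by simpa [aeval_comp] using congr(Polynomial.aeval x $h))
  have hpow : ((C a * X + C b) * (C c * (C ζ * X) + C d)) ^ n =
      ((C a * (C ζ * X) + C b) * (C c * X + C d)) ^ n := by
    refine mul_right_cancel₀ hq ?_
    rw [mul_pow, mul_pow]
    linear_combination (C c * X + C d) ^ n * hrel' - (C c * (C ζ * X) + C d) ^ n * hrel
  have heval (t : k) : ((a * t + b) * (c * (ζ * t) + d)) ^ n =
      ((a * (ζ * t) + b) * (c * t + d)) ^ n := by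
    simpa using congr(($hpow).eval t)
  have hd (hc : c ≠ 0) : d = 0 := by
    have hct : c * (-d / c) = -d := mul_div_cancel₀ _ hc
    have h := heval (-d / c)
    rw [hct, neg_add_cancel, mul_zero, zero_pow hn0] at h
    rcases mul_eq_zero.mp (eq_zero_of_pow_eq_zero h) with h | h
    · exact (hdet (by linear_combination a * hct - c * h)).elim
    · exact (mul_eq_zero.mp (by linear_combination ζ * hct - h : (ζ - 1) * d = 0)).resolve_left
        (sub_ne_zero.mpr hζ1)
  have hb (ha : a ≠ 0) : b = 0 := by
    have hat : a * (-b / a) = -b := mul_div_cancel₀ _ ha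
    have h := heval (-b / a)
    rw [hat, neg_add_cancel, zero_mul, zero_pow hn0] at h
    rcases mul_eq_zero.mp (eq_zero_of_pow_eq_zero h.symm) with h | h
    · exact (mul_eq_zero.mp (by linear_combination ζ * hat - h : (ζ - 1) * b = 0)).resolve_left
        (sub_ne_zero.mpr hζ1)
    · exact (hdet (by linear_combination a * h - c * hat)).elim
  by_cases hc : c = 0
  · have ha : a ≠ 0 := by rintro rfl; simp [hc] at hdet
    have hd0 : algebraMap k F d ≠ 0 := by
      rw [_root_.map_ne_zero]; rintro rfl; simp [hc] at hdet
    refine ⟨a / d, .inl ?_⟩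
    rw [map_div₀, div_mul_eq_mul_div, eq_div_iff hd0]
    simpa [hc, hb ha, mul_comm] using hy
  · have ha : a = 0 := by
      by_contra ha
      simp [hd hc, hb ha] at hdet
    have hc0 : algebraMap k F c ≠ 0 := (_root_.map_ne_zero _).mpr hc
    refine ⟨b / c, .inr ?_⟩
    rw [map_div₀, eq_div_iff hc0]
    simp only [ha, hd hc, map_zero] at hy
    linear_combination hy

theorem Transcendental.eq_self_of_eq_mul_or_mul_eq (hx : Transcendental k x) {c c' : k}
    (hc : y = algebraMap k F c * x ∨ x * y = algebraMap k F c)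
    (hc' : y - 1 = algebraMap k F c' * (x - 1) ∨ (x - 1) * (y - 1) = algebraMap k F c')
    (hy : y ≠ 0) : y = x := by
  rcases hc with h | h <;> rcases hc' with h' | h'
  · obtain ⟨-, h1, h0⟩ := hx.coeffs_eq_zero_of_quadratic (a := 0) (b := c - c') (c := c' - 1)
      (by simp only [map_sub, map_zero, map_one]; linear_combination h' - h)
    obtain rfl : c = 1 := by linear_combination h1 + h0
    simpa using h
  · obtain ⟨h2, -, -⟩ := hx.coeffs_eq_zero_of_quadratic (a := c) (b := -c - 1) (c := 1 - c')
      (by simp only [map_sub, map_neg, map_one]; linear_combination h' - (x - 1) * h)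
    simp [h, h2] at hy
  · obtain ⟨h2, h1, -⟩ := hx.coeffs_eq_zero_of_quadratic (a := -c') (b := c' - 1) (c := c)
      (by simp only [map_sub, map_neg, map_one]; linear_combination x * h' - h)
    exact (one_ne_zero (by linear_combination -h2 - h1 : (1 : k) = 0)).elim
  · obtain ⟨h2, -, -⟩ := hx.coeffs_eq_zero_of_quadratic (a := -1) (b := c + 1 - c') (c := -c)
      (by simp only [map_sub, map_neg, map_one, map_add]; linear_combination x * h' - (x - 1) * h)
    simp at h2

end

/-- Let `F|k` be an extension of algebraically closed fields with
`trdeg(F|k) = 1`.  If `σ` is a field automorphism of `F` mapping `k` onto `k` and mapping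
every function field in `F` (finitely generated intermediate field `≠ k`) onto itself,
then `σ` is the identity. -/
theorem stmt18 {k F : Type*} [Field k] [Field F] [Algebra k F]
    [IsAlgClosed k] [IsAlgClosed F]
    (htr : ∃ x : F, Transcendental k x ∧
      Algebra.IsAlgebraic (IntermediateField.adjoin k {x}) F)
    (σ : F ≃+* F)
    (hk : σ '' Set.range (algebraMap k F) = Set.range (algebraMap k F))
    (hK : ∀ K : IntermediateField k F, K.FG → K ≠ ⊥ → σ '' (K : Set F) = (K : Set F)) :
    σ = RingEquiv.refl F := by
  obtain ⟨n, ζ, hn0, hζ, hζ1⟩ := IsAlgClosed.exists_pow_eq_one_ne_one k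
  have himg {z : F} (hz : z ∉ Set.range (algebraMap k F)) : σ '' (k⟮z⟯ : Set F) = k⟮z⟯ :=
    hK _ ⟨{z}, by simp⟩ fun h =>
      hz (mem_bot.mp (adjoin_simple_eq_bot_iff.mp h))
  have hrange {z : F} (hz : Transcendental k z) : z ∉ Set.range (algebraMap k F) := by
    rintro ⟨a, rfl⟩
    exact hz (isAlgebraic_algebraMap a)
  have hmul {z : F} (hz : Transcendental k z) :
      ∃ c : k, σ z = algebraMap k F c * z ∨ z * σ z = algebraMap k F c := by
    have hσz : σ z ∉ Set.range (algebraMap k F) := by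
      rw [← hk]
      rintro ⟨w, hw, hwz⟩
      exact hrange hz (σ.injective hwz ▸ hw)
    have h1 : σ z ∈ k⟮z⟯ := by
      rw [← SetLike.mem_coe, ← himg (hrange hz)]
      exact Set.mem_image_of_mem σ (mem_adjoin_simple_self k z)
    have h2 : z ∈ k⟮σ z⟯ := by
      have := mem_adjoin_simple_self k (σ z)
      rw [← SetLike.mem_coe, ← himg hσz] at this
      exact (σ.injective.mem_set_image).mp this
    refine hz.eq_mul_or_mul_eq_of_pow_mem_adjoin (le_antisymm
      (adjoin_simple_le_iff.mpr h2) (adjoin_simple_le_iff.mpr h1)) hn0 ?_ hζ hζ1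
    rw [← map_pow, ← SetLike.mem_coe, ← himg (hrange (hz.pow (Nat.pos_of_ne_zero hn0)))]
    exact Set.mem_image_of_mem σ (mem_adjoin_simple_self k _)
  have hfix {z : F} (hz : Transcendental k z) : σ z = z := by
    obtain ⟨c, hc⟩ := hmul hz
    have hz1 : Transcendental k (z - 1) := fun h => hz (by simpa using h.add isAlgebraic_one)
    obtain ⟨c', hc'⟩ := hmul hz1
    rw [map_sub, map_one] at hc'
    exact hz.eq_self_of_eq_mul_or_mul_eq hc hc' 
      ((_root_.map_ne_zero σ).mpr fun h => hz (h ▸ isAlgebraic_zero))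
  obtain ⟨x, hx, -⟩ := htr
  ext z
  by_cases hz : IsAlgebraic k z
  · have hxz : Transcendental k (x + z) := fun h => hx (by simpa using h.sub hz)
    simpa [hfix hx] using hfix hxz
  · exact hfix hz
end

section
/- Let F|k be an extension of algebraically closed fields of characteristic p > 0 with trdeg(F|k) = 1. Suppose σ is a field automorphism of F with σ(k) = k and σ(K^i) = K^i for every function field K in F, where K^i denotes the perfect closure of K in F. Then σ is an integral power of the Frobenius automorphism: there exists n ∈ ℤ with σ = Frob^n, where Frob : F ≅ F is x ↦ x^p. -/
open Polynomial in
theorem rootMultiplicity_comp_X_pow_add_C {k : Type*} [Field k] {A : k[X]} (hA : A ≠ 0) {l : ℕ}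
    (hl : (l : k) ≠ 0) {y : k} (hy : y ≠ 0) (a : k) :
    rootMultiplicity y (A.comp (X ^ l + C a)) = rootMultiplicity (y ^ l + a) A := by
  classical
  have hl0 : l ≠ 0 := by rintro rfl; simp at hl
  obtain ⟨q, hq, hdvd⟩ := exists_eq_pow_rootMultiplicity_mul_and_not_dvd A hA (y ^ l + a)
  set m := rootMultiplicity (y ^ l + a) A
  rw [dvd_iff_isRoot] at hdvd
  have hcomp : A.comp (X ^ l + C a) = (X ^ l - C (y ^ l)) ^ m * q.comp (X ^ l + C a) := by
    conv_lhs => rw [hq]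
    rw [mul_comp, pow_comp, sub_comp, X_comp, C_comp, C_add, add_sub_add_right_eq_sub]
  have hq' : ¬ (q.comp (X ^ l + C a)).IsRoot y := by
    simpa [IsRoot, eval_comp] using hdvd
  have hq0 : q.comp (X ^ l + C a) ≠ 0 := by
    intro h; rw [h] at hq'; simp at hq'
  have hX0 : (X ^ l - C (y ^ l) : k[X]) ≠ 0 := X_pow_sub_C_ne_zero (Nat.pos_of_ne_zero hl0) _
  have h1 : rootMultiplicity y (X ^ l - C (y ^ l) : k[X]) = 1 := by
    apply le_antisymm
    · exact rootMultiplicity_le_one_of_separable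
        (separable_X_pow_sub_C _ hl (pow_ne_zero _ hy)) y
    · rw [Nat.one_le_iff_ne_zero, ← Nat.pos_iff_ne_zero, rootMultiplicity_pos hX0]
      simp [IsRoot]
  rw [hcomp, ← count_roots, roots_mul (mul_ne_zero (pow_ne_zero _ hX0) hq0), roots_pow,
    Multiset.count_add, Multiset.count_nsmul, count_roots, count_roots, h1,
    rootMultiplicity_eq_zero hq']
  simp

open Polynomial in
/-- If `A / B`, evaluated at `X ^ l + a`, is an `l`-th power up to exponents prime to `l`, and
`l` exceeds the degree of `A`, then `a` is the only possible root of `A`. -/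
theorem eq_of_isRoot_of_comp_X_pow_add_C {k : Type*} [Field k] [IsAlgClosed k] {A B u v : k[X]}
    (hA : A ≠ 0) (hB : B ≠ 0) (hu : u ≠ 0) (hv : v ≠ 0) (hAB : IsCoprime A B)
    {l P Q : ℕ} (hl : (l : k) ≠ 0) (hlQ : l.Coprime Q) (hdeg : A.natDegree < l) {a : k}
    (h : A.comp (X ^ l + C a) ^ Q * v ^ (l * P) = u ^ (l * P) * B.comp (X ^ l + C a) ^ Q)
    {r : k} (hr : A.IsRoot r) : r = a := by
  classical
  by_contra hra
  have hl0 : 0 < l := by omega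
  obtain ⟨y, hy⟩ := IsAlgClosed.exists_pow_nat_eq (r - a) hl0
  have hy0 : y ≠ 0 := by
    rintro rfl
    rw [zero_pow hl0.ne'] at hy
    exact hra (sub_eq_zero.mp hy.symm)
  have hyr : y ^ l + a = r := by rw [hy]; ring
  have hcomp0 : ∀ D : k[X], D ≠ 0 → D.comp (X ^ l + C a) ≠ 0 := by
    intro D hD h0
    rw [comp_eq_zero_iff] at h0
    rcases h0 with h0 | ⟨-, h0⟩
    · exact hD h0
    · have := congrArg natDegree h0
      rw [natDegree_X_pow_add_C, natDegree_C] at this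
      omega
  have hBr : ¬ B.IsRoot r := by
    intro hB'
    obtain ⟨c, d, hcd⟩ := hAB
    have := congrArg (eval r) hcd
    rw [IsRoot] at hr hB'
    simp [hr, hB'] at this
  have h2 := congrArg (fun q => Multiset.count y q.roots) h
  rw [roots_mul (mul_ne_zero (pow_ne_zero _ (hcomp0 _ hA)) (pow_ne_zero _ hv)),
    roots_mul (mul_ne_zero (pow_ne_zero _ hu) (pow_ne_zero _ (hcomp0 _ hB)))] at h2
  simp only [roots_pow, Multiset.count_add, Multiset.count_nsmul, count_roots] at h2
  rw [rootMultiplicity_comp_X_pow_add_C hA hl hy0, rootMultiplicity_comp_X_pow_add_C hB hl hy0,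
    hyr, rootMultiplicity_eq_zero hBr, mul_zero, add_zero] at h2
  have hdvd : l ∣ Q * rootMultiplicity r A := by
    have hv' : l ∣ l * P * rootMultiplicity y v := by
      rw [mul_assoc]
      exact dvd_mul_right _ _
    rw [← Nat.dvd_add_left hv', h2, mul_assoc]
    exact dvd_mul_right _ _
  have hle : rootMultiplicity r A ≤ A.natDegree := by
    rw [← count_roots]
    exact (Multiset.count_le_card _ _).trans (card_roots' A)
  have hpos := (rootMultiplicity_pos hA).mpr hr
  have := Nat.le_of_dvd hpos (hlQ.dvd_of_dvd_mul_left hdvd)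
  omega

open Polynomial in
theorem eq_C_mul_X_sub_C_pow_of_forall_isRoot {k : Type*} [Field k] [IsAlgClosed k] {q : k[X]}
    {a : k} (h : ∀ r, q.IsRoot r → r = a) (hq : q ≠ 0) :
    q = C q.leadingCoeff * (X - C a) ^ q.natDegree := by
  have hs := IsAlgClosed.splits q
  have hrep : q.roots = Multiset.replicate q.natDegree a := by
    rw [Multiset.eq_replicate]
    exact ⟨hs.natDegree_eq_card_roots.symm, fun r hr => h r ((mem_roots hq).mp hr)⟩
  conv_lhs => rw [hs.eq_prod_roots, hrep]
  simp

/-- An additive power map on an infinite field of characteristic `p` has exponent a power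
of `p`. -/
theorem exists_eq_prime_pow_of_forall_add_one_pow {k : Type*} [Field k] [Infinite k] {p : ℕ}
    (hp : p.Prime) [CharP k p] {N : ℕ} (hN : N ≠ 0) (h : ∀ a : k, (a + 1) ^ N = a ^ N + 1) :
    ∃ j, N = p ^ j := by
  open Polynomial in
  have := Fact.mk hp
  obtain ⟨j, m, hm, rfl⟩ := Nat.exists_eq_pow_mul_and_not_dvd hN p hp.ne_one
  refine ⟨j, ?_⟩
  have hpoly : ((X + 1) ^ m : k[X]) = X ^ m + 1 := by
    apply Polynomial.funext
    intro a
    apply iterateFrobenius_inj k p j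
    have := h a
    simp only [iterateFrobenius_def, eval_pow, eval_add, eval_X, eval_one]
    rw [add_pow_char_pow, ← pow_mul, ← pow_mul, mul_comm m, this, one_pow]
  have hd := congrArg (fun q => eval 0 (derivative q)) hpoly
  have hm0 : m ≠ 0 := by rintro rfl; simp at hm
  by_cases hm1 : m = 1
  · simp [hm1]
  · have hm2 : m - 1 ≠ 0 := by omega
    exfalso
    apply hm
    rw [← CharP.cast_eq_zero_iff k]
    simpa [derivative_pow, hm2] using hd

theorem pow_right_injective_of_infinite {k : Type*} [Field k] [Infinite k] {m n : ℕ}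
    (h : ∀ a : k, a ^ m = a ^ n) : m = n := by
  open Polynomial in
  have : (X ^ m : k[X]) = X ^ n := Polynomial.funext fun a => by simpa using h a
  simpa using congrArg natDegree this

open Polynomial in
theorem exists_coprime_of_mem_perfectClosure_adjoin {k F : Type*} [Field k] [Field F] [Algebra k F]
    (p : ℕ) [ExpChar F p] {x z : F} (hx : Transcendental k x)
    (hz : z ∈ perfectClosure (IntermediateField.adjoin k {x}) F) :
    ∃ (n : ℕ) (f g : k[X]), g ≠ 0 ∧ IsCoprime f g ∧ z ^ p ^ n * aeval x g = aeval x f := by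
  classical
  have : ExpChar (IntermediateField.adjoin k {x}) p :=
    (RingHom.expChar_iff (algebraMap (IntermediateField.adjoin k {x}) F)
      (algebraMap (IntermediateField.adjoin k {x}) F).injective p).mpr inferInstance
  rw [mem_perfectClosure_iff_pow_mem p] at hz
  obtain ⟨n, w, hw⟩ := hz
  obtain ⟨r, s, hrs⟩ := (IntermediateField.mem_adjoin_simple_iff k (w : F)).mp w.2
  have hw' : z ^ p ^ n = aeval x r / aeval x s := by rw [← hrs, ← hw]; rfl
  have hne : ∀ q : k[X], q ≠ 0 → aeval x q ≠ 0 := fun q hq h0 => hq (transcendental_iff.mp hx q h0)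
  by_cases hs : s = 0
  · exact ⟨n, 0, 1, one_ne_zero, isCoprime_one_right, by simp [hw', hs]⟩
  let := EuclideanDomain.gcdMonoid k[X]
  obtain ⟨f, g, hf, hg, hu⟩ := extract_gcd r s
  have hg0 : g ≠ 0 := by
    rintro rfl
    exact hs (by rw [hg, mul_zero])
  refine ⟨n, f, g, hg0, (gcd_isUnit_iff f g).mp hu, ?_⟩
  have hd : GCDMonoid.gcd r s ≠ 0 := gcd_ne_zero_of_right hs
  have h1 := hne _ hs
  rw [hw', div_mul_eq_mul_div, div_eq_iff h1]
  conv_lhs => rw [hf]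
  conv_rhs => rw [hg]
  simp only [map_mul]
  ring

open Polynomial in
/-- Comparing the representations of `σ x` and of `σ y`, where `y ^ l = x - a` with `l` large and
prime to `p`, shows that `a` is the only zero of `f - σ (a) ^ p ^ n * g` and of `g`. -/
theorem eq_of_isRoot_of_representation {k F : Type*} [Field k] [Field F] [Algebra k F]
    [IsAlgClosed k] [IsAlgClosed F] (p : ℕ) (hp : p.Prime) [CharP k p] [CharP F p]
    (σ : F ≃+* F) (s : k → k) (hs : ∀ a, σ (algebraMap k F a) = algebraMap k F (s a))
    (hrep : ∀ x : F, Transcendental k x → ∃ (n : ℕ) (f g : k[X]), g ≠ 0 ∧ IsCoprime f g ∧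
      σ x ^ p ^ n * aeval x g = aeval x f)
    {x : F} (hx : Transcendental k x) {n : ℕ} {f g : k[X]} (hg : g ≠ 0) (hfg : IsCoprime f g)
    (h : σ x ^ p ^ n * aeval x g = aeval x f) (a : k) :
    f - C (s a ^ p ^ n) * g ≠ 0 ∧ (∀ r, (f - C (s a ^ p ^ n) * g).IsRoot r → r = a) ∧
      ∀ r, g.IsRoot r → r = a := by
  have := Fact.mk hp
  set A := f - C (s a ^ p ^ n) * g with hA
  let l := 1 + p * (A.natDegree + g.natDegree)
  have hlk : (l : k) ≠ 0 := by simp [l]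
  have hlp : l.Coprime p := by simp [l]
  have hp1 := hp.one_lt
  have hlA : A.natDegree < l := by simp only [l]; nlinarith
  have hlg : g.natDegree < l := by simp only [l]; nlinarith
  have hl0 : 0 < l := by omega
  obtain ⟨y, hy⟩ := IsAlgClosed.exists_pow_nat_eq (x - algebraMap k F a) hl0
  have hxy : x = aeval y (X ^ l + C a : k[X]) := by simp [hy]
  have hyt : Transcendental k y := by
    intro hya
    apply hx
    rw [← sub_add_cancel x (algebraMap k F a), ← hy]
    exact (hya.pow l).add (isAlgebraic_algebraMap a)
  have hne : ∀ {z : F}, Transcendental k z → ∀ q : k[X], q ≠ 0 → aeval z q ≠ 0 :=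
    fun hz q hq h0 => hq (transcendental_iff.mp hz q h0)
  have hy0 : y ≠ 0 := by
    rintro rfl
    exact hyt isAlgebraic_zero
  have hSy : σ y ≠ 0 := by simpa using hy0
  obtain ⟨n', u, v, hv, -, huv⟩ := hrep y hyt
  have hu : u ≠ 0 := by
    rintro rfl
    rw [map_zero] at huv
    exact mul_ne_zero (pow_ne_zero _ hSy) (hne hyt v hv) huv
  have hσ : σ y ^ l = σ x - algebraMap k F (s a) := by rw [← map_pow, hy, map_sub, hs]
  have hAx : aeval x A = σ y ^ (l * p ^ n) * aeval x g := by
    rw [pow_mul, hσ, sub_pow_char_pow, sub_mul, h, hA]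
    simp
  have hA0 : A ≠ 0 := by
    intro h0
    rw [h0, map_zero] at hAx
    exact mul_ne_zero (pow_ne_zero _ hSy) (hne hx g hg) hAx.symm
  have hAg : IsCoprime A g := by
    obtain ⟨c, d, hcd⟩ := hfg
    exact ⟨c, d + c * C (s a ^ p ^ n), by rw [← hcd, hA]; ring⟩
  have hid : A.comp (X ^ l + C a) ^ p ^ n' * v ^ (l * p ^ n) =
      u ^ (l * p ^ n) * g.comp (X ^ l + C a) ^ p ^ n' := by
    apply transcendental_iff_injective.mp hyt
    simp only [map_mul, map_pow, aeval_comp, ← hxy]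
    rw [hAx, ← huv]
    ring
  have hlQ : l.Coprime (p ^ n') := hlp.pow_right n'
  exact ⟨hA0, fun r hr => eq_of_isRoot_of_comp_X_pow_add_C hA0 hg hu hv hAg hlk hlQ hlA hid hr,
    fun r hr => eq_of_isRoot_of_comp_X_pow_add_C hg hA0 hv hu hAg.symm hlk hlQ hlg
      (by rw [mul_comm, ← hid, mul_comm]) hr⟩

open Polynomial in
theorem exists_pow_eq_pow_of_representation {k F : Type*} [Field k] [Field F] [Algebra k F]
    [IsAlgClosed k] [IsAlgClosed F] (p : ℕ) (hp : p.Prime) [CharP k p] [CharP F p]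
    (σ : F ≃+* F) (s : k → k) (hs : ∀ a, σ (algebraMap k F a) = algebraMap k F (s a))
    (hσ : ∀ x : F, Transcendental k x → Transcendental k (σ x))
    (hrep : ∀ x : F, Transcendental k x → ∃ (n : ℕ) (f g : k[X]), g ≠ 0 ∧ IsCoprime f g ∧
      σ x ^ p ^ n * aeval x g = aeval x f)
    {x : F} (hx : Transcendental k x) :
    ∃ n j : ℕ, σ x ^ p ^ n = x ^ p ^ j ∧ ∀ a, s a ^ p ^ n = a ^ p ^ j := by
  obtain ⟨n, f, g, hg, hfg, h⟩ := hrep x hx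
  have key := eq_of_isRoot_of_representation p hp σ s hs hrep hx hg hfg h
  have hs0 : s 0 = 0 := (algebraMap k F).injective (by rw [← hs]; simp)
  have hs1 : s 1 = 1 := (algebraMap k F).injective (by rw [← hs]; simp)
  have hadd : ∀ a, s (a + 1) = s a + 1 := fun a =>
    (algebraMap k F).injective (by rw [← hs, map_add, map_add, hs]; simp)
  have hpn : p ^ n ≠ 0 := pow_ne_zero _ hp.ne_zero
  have hgdeg : g.degree = 0 := by
    by_contra hd
    obtain ⟨r, hr⟩ := IsAlgClosed.exists_root g hd
    exact zero_ne_one (((key 0).2.2 r hr).symm.trans ((key 1).2.2 r hr))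
  obtain ⟨c, hc⟩ : ∃ c, g = C c := ⟨_, eq_C_of_degree_eq_zero hgdeg⟩
  subst hc
  have hc0 : c ≠ 0 := by simpa using hg
  have hN : f.natDegree ≠ 0 := by
    intro hf
    rw [natDegree_eq_zero] at hf
    obtain ⟨d, rfl⟩ := hf
    apply hσ x hx
    refine IsAlgebraic.of_pow (Nat.pos_of_ne_zero hpn) ?_
    have : σ x ^ p ^ n = algebraMap k F (d / c) := by
      rw [map_div₀, eq_div_iff (by simpa using hc0)]
      simpa using h
    rw [this]
    exact isAlgebraic_algebraMap _
  have hshape : ∀ a, f = C (s a ^ p ^ n * c) + C f.leadingCoeff * (X - C a) ^ f.natDegree := by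
    intro a
    obtain ⟨h0, hr, -⟩ := key a
    have := eq_C_mul_X_sub_C_pow_of_forall_isRoot hr h0
    rw [← C_mul] at this
    have hdeg : (f - C (s a ^ p ^ n * c)).natDegree = f.natDegree := natDegree_sub_C
    have hlead : (f - C (s a ^ p ^ n * c)).leadingCoeff = f.leadingCoeff :=
      leadingCoeff_sub_of_degree_lt
        (degree_C_le.trans_lt (natDegree_pos_iff_degree_pos.mp (Nat.pos_of_ne_zero hN)))
    rw [hdeg, hlead] at this
    rw [← this]
    ring
  set N := f.natDegree
  set b := f.leadingCoeff
  have hf0 : f = C b * X ^ N := by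
    have := hshape 0
    simpa [hs0, hp.ne_zero] using this
  have heval : ∀ a, b * a ^ N = s a ^ p ^ n * c := by
    intro a
    have h1 := congrArg (eval a) (hshape a)
    have h2 := congrArg (eval a) hf0
    rw [h2] at h1
    simpa [hN] using h1
  have hbc : b = c := by simpa [hs1] using heval 1
  have hpow : ∀ a, s a ^ p ^ n = a ^ N := by
    intro a
    have := heval a
    rw [hbc, mul_comm] at this
    exact (mul_right_cancel₀ hc0 this).symm
  have := Fact.mk hp
  obtain ⟨j, hj⟩ := exists_eq_prime_pow_of_forall_add_one_pow (k := k) hp hN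
    (fun a => by rw [← hpow, ← hpow, hadd, add_pow_char_pow, one_pow])
  rw [hj] at hpow
  refine ⟨n, j, ?_, hpow⟩
  rw [hf0, hbc, hj] at h
  have hc' : algebraMap k F c ≠ 0 := by simpa using hc0
  apply mul_right_cancel₀ hc'
  rw [mul_comm (x ^ p ^ j)]
  simpa using h


/-- Let `F|k` be an extension of algebraically closed fields of
characteristic `p > 0` with `trdeg(F|k) = 1`.  If `σ` is a field automorphism of `F`
mapping `k` onto `k` and mapping `Kⁱ` (the perfect closure of `K` in `F`) onto itself for
every function field `K` in `F`, then `σ` is an integral power of Frobenius: there is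
`n : ℕ` with `σ = Frob^n` (i.e. `σ x = x ^ p ^ n` for all `x`) or `σ = Frob^(-n)`
(i.e. `(σ x) ^ p ^ n = x` for all `x`). -/
theorem stmt19 {k F : Type*} [Field k] [Field F] [Algebra k F]
    [IsAlgClosed k] [IsAlgClosed F]
    (p : ℕ) (hp : p.Prime) [CharP F p]
    (htr : ∃ x : F, Transcendental k x ∧
      Algebra.IsAlgebraic (IntermediateField.adjoin k {x}) F)
    (σ : F ≃+* F)
    (hk : σ '' Set.range (algebraMap k F) = Set.range (algebraMap k F))
    (hK : ∀ K : IntermediateField k F, K.FG → K ≠ ⊥ →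
      σ '' (((perfectClosure K F).restrictScalars k : IntermediateField k F) : Set F) =
        (((perfectClosure K F).restrictScalars k : IntermediateField k F) : Set F)) :
    ∃ n : ℕ, (∀ x : F, σ x = x ^ p ^ n) ∨ (∀ x : F, (σ x) ^ p ^ n = x) := by
  have : Fact p.Prime := ⟨hp⟩
  have : CharP k p := (RingHom.charP_iff (algebraMap k F) (algebraMap k F).injective p).mpr
    inferInstance
  have : ExpChar F p := ExpChar.prime hp
  have hsurj : ∀ x : F, Transcendental k x ∨ ∃ a, algebraMap k F a = x := by
    intro x
    by_cases hx : Transcendental k x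
    · exact Or.inl hx
    · right
      rw [Transcendental, not_not] at hx
      have := IntermediateField.isAlgebraic_adjoin_simple hx.isIntegral
      have hxK := IntermediateField.mem_adjoin_simple_self k x
      rwa [IntermediateField.eq_bot_of_isAlgClosed_of_isAlgebraic
        (IntermediateField.adjoin k {x}), IntermediateField.mem_bot] at hxK
  have hs : ∀ a, ∃ b, σ (algebraMap k F a) = algebraMap k F b := by
    intro a
    have : σ (algebraMap k F a) ∈ Set.range (algebraMap k F) :=
      hk ▸ Set.mem_image_of_mem σ ⟨a, rfl⟩
    obtain ⟨b, hb⟩ := this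
    exact ⟨b, hb.symm⟩
  choose s hs using hs
  have hσ : ∀ x : F, Transcendental k x → Transcendental k (σ x) := by
    intro x hx
    rcases hsurj (σ x) with h | ⟨a, ha⟩
    · exact h
    · have : σ x ∈ σ '' Set.range (algebraMap k F) := by
        rw [hk]
        exact ⟨a, ha⟩
      obtain ⟨y, ⟨b, rfl⟩, hb⟩ := this
      exact absurd (isAlgebraic_algebraMap b) (σ.injective hb ▸ hx)
  open Polynomial in
  have hrep : ∀ x : F, Transcendental k x → ∃ (n : ℕ) (f g : k[X]), g ≠ 0 ∧ IsCoprime f g ∧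
      σ x ^ p ^ n * aeval x g = aeval x f := by
    intro x hx
    apply exists_coprime_of_mem_perfectClosure_adjoin p hx
    have hxK := IntermediateField.mem_adjoin_simple_self k x
    have hK' := hK (IntermediateField.adjoin k {x})
      (IntermediateField.fg_adjoin_of_finite (Set.finite_singleton x)) (by
        intro h
        rw [h, IntermediateField.mem_bot] at hxK
        obtain ⟨a, rfl⟩ := hxK
        exact hx (isAlgebraic_algebraMap a))
    have hmem : σ x ∈ σ '' (((perfectClosure (IntermediateField.adjoin k {x}) F).restrictScalars k :
        IntermediateField k F) : Set F) :=
      ⟨x, (perfectClosure (IntermediateField.adjoin k {x}) F).algebraMap_mem ⟨x, hxK⟩, rfl⟩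
    rw [hK'] at hmem
    exact hmem
  have hmain := fun {x} => exists_pow_eq_pow_of_representation p hp σ s hs hσ hrep (x := x)
  obtain ⟨x, hx, -⟩ := htr
  obtain ⟨n, j, -, hnj⟩ := hmain hx
  have hall : ∀ y, σ y ^ p ^ n = y ^ p ^ j := by
    intro y
    rcases hsurj y with hy | ⟨a, rfl⟩
    · obtain ⟨n', j', hy', hnj'⟩ := hmain hy
      have hexp : p ^ (j + n') = p ^ (j' + n) := by
        apply pow_right_injective_of_infinite (k := k)
        intro a
        rw [pow_add, pow_mul, ← hnj, pow_add, pow_mul, ← hnj', ← pow_mul, ← pow_mul, mul_comm]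
      apply iterateFrobenius_inj F p n'
      simp only [iterateFrobenius_def]
      rw [← pow_mul, mul_comm, pow_mul, hy', ← pow_mul, ← pow_mul, ← pow_add, ← pow_add, hexp]
    · rw [hs, ← map_pow, ← map_pow, hnj]
  rcases le_total n j with hle | hle
  · obtain ⟨m, rfl⟩ := Nat.exists_eq_add_of_le hle
    refine ⟨m, Or.inl fun y => iterateFrobenius_inj F p n ?_⟩
    simp only [iterateFrobenius_def]
    rw [hall, ← pow_mul, ← pow_add, add_comm]
  · obtain ⟨m, rfl⟩ := Nat.exists_eq_add_of_le hle
    refine ⟨m, Or.inr fun y => iterateFrobenius_inj F p j ?_⟩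
    simp only [iterateFrobenius_def]
    rw [← hall y, ← pow_mul, ← pow_add, add_comm]
end
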